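/- arXiv:dg-ga/9604003 — 2 statements merged into one kernel-verified Lean document; each statement's English description precedes it below -/
import Mathlib

section
/- Let f be a profile function whose derivative f' extends continuously to [-1,1], and let Λ : ℕ → ℝ be the strictly increasing enumeration of E(f) = ⋃_{k ≥ 0} Spec L_k. Let m ≥ 1 and l ≥ 1 be integers such that x ↦ f(x)^l · f''(x) is interval integrable on [-1,1], and set K(x) = -f''(x)/2. Then Λ(m) ≤ m² · (∫_{-1}^{1} f(x)^{l-1} dx)/(∫_{-1}^{1} f(x)^{l} dx) + (l · ∫_{-1}^{1} f(x)^{l} K(x) dx)/(2 · ∫_{-1}^{1} f(x)^{l} dx). -/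
open Set MeasureTheory intervalIntegral Filter

/-- A profile function for a surface of revolution diffeomorphic to `S²` of area `4π`:
continuous on `[-1,1]`, smooth and positive on `(-1,1)`, vanishing at `±1`,
with derivative `2` at `-1` and `-2` at `1`. -/
structure IsProfile (f : ℝ → ℝ) : Prop where
  contOn : ContinuousOn f (Icc (-1) 1)
  smoothOn : ContDiffOn ℝ (⊤ : ℕ∞) f (Ioo (-1) 1)
  pos : ∀ x ∈ Ioo (-1:ℝ) 1, 0 < f x
  zero_neg_one : f (-1) = 0
  zero_one : f 1 = 0
  deriv_neg_one : HasDerivAt f 2 (-1)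
  deriv_one : HasDerivAt f (-2) 1

/-- `λ` is an eigenvalue of the Sturm–Liouville operator
`L_k = -(d/dx)(f(x) d/dx) + k²/f(x)` on `(-1,1)`, with Dirichlet boundary
conditions at `±1` when `k ≥ 1`. -/
def InSpec (f : ℝ → ℝ) (k : ℕ) (lam : ℝ) : Prop :=
  ∃ u : ℝ → ℝ, ContinuousOn u (Icc (-1) 1) ∧ ContDiffOn ℝ (⊤ : ℕ∞) u (Ioo (-1) 1) ∧
    (∃ x ∈ Ioo (-1:ℝ) 1, u x ≠ 0) ∧
    (1 ≤ k → u (-1) = 0 ∧ u 1 = 0) ∧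
    ∀ x ∈ Ioo (-1:ℝ) 1,
      -(deriv (fun y => f y * deriv u y) x) + ((k:ℝ)^2 / f x) * u x = lam * u x

/-- The spectrum of `L_k`. -/
def Spec (f : ℝ → ℝ) (k : ℕ) : Set ℝ := {lam | InSpec f k lam}

/-- The set of distinct eigenvalues of the Laplacian of the surface of
revolution determined by `f`. -/
def Eigs (f : ℝ → ℝ) : Set ℝ := ⋃ k : ℕ, Spec f k

/-- A nonnegative bounded kernel on a space `X`, measurable in its second variable and
continuous in its first. -/
structure IsBoundedKernel {X : Type*} [TopologicalSpace X] [MeasurableSpace X]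
    (G : X → X → ℝ) (C : ℝ) : Prop where
  nonneg : ∀ x z, 0 ≤ G x z
  le : ∀ x z, G x z ≤ C
  continuous_left : ∀ z, Continuous fun x => G x z
  measurable_right : ∀ x, Measurable (G x)

namespace IsBoundedKernel

variable {X : Type*} [TopologicalSpace X] [MeasurableSpace X] {μ : Measure X}
  {G : X → X → ℝ} {C : ℝ}

theorem abs_le (hG : IsBoundedKernel G C) (x z : X) : |G x z| ≤ C := by
  rw [abs_of_nonneg (hG.nonneg x z)]; exact hG.le x z

theorem abs_mul_le (hG : IsBoundedKernel G C) {v : X → ℝ} {B : ℝ} (hB : ∀ z, |v z| ≤ B)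
    (x z : X) : ‖G x z * v z‖ ≤ C * B := by
  rw [norm_mul]
  exact mul_le_mul (hG.abs_le x z) (hB z) (norm_nonneg _)
    ((abs_nonneg _).trans (hG.abs_le x z))

theorem integrable_mul [IsFiniteMeasure μ] (hG : IsBoundedKernel G C) {v : X → ℝ}
    (hv : Measurable v) {B : ℝ} (hB : ∀ z, |v z| ≤ B) (x : X) :
    Integrable (fun z => G x z * v z) μ :=
  Integrable.of_bound ((hG.measurable_right x).mul hv).aestronglyMeasurable (C * B)
    (Eventually.of_forall (hG.abs_mul_le hB x))

theorem continuous_integral [FirstCountableTopology X] [IsFiniteMeasure μ]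
    (hG : IsBoundedKernel G C) {v : X → ℝ}
    (hv : Measurable v) {B : ℝ} (hB : ∀ z, |v z| ≤ B) :
    Continuous fun x => ∫ z, G x z * v z ∂μ :=
  continuous_of_dominated
    (fun x => ((hG.measurable_right x).mul hv).aestronglyMeasurable)
    (fun x => Eventually.of_forall (hG.abs_mul_le hB x)) (integrable_const (C * B))
    (Eventually.of_forall fun z => (hG.continuous_left z).mul continuous_const)

/-- The kernel is continuous in its first variable as a map into `L¹`. -/
theorem tendsto_integral_abs_sub [FirstCountableTopology X] [IsFiniteMeasure μ]
    (hG : IsBoundedKernel G C) (x : X) :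
    Tendsto (fun y => ∫ z, |G x z - G y z| ∂μ) (nhds x) (nhds 0) := by
  have h : Continuous fun y => ∫ z, |G x z - G y z| ∂μ := by
    refine continuous_of_dominated (bound := fun _ => C + C) (fun y => ?_) (fun y => ?_)
      (integrable_const _) (Eventually.of_forall fun z => ?_)
    · exact (((hG.measurable_right x).sub (hG.measurable_right y)).abs).aestronglyMeasurable
    · refine Eventually.of_forall fun z => ?_
      rw [Real.norm_eq_abs, abs_abs]
      exact (abs_sub _ _).trans (add_le_add (hG.abs_le x z) (hG.abs_le y z))
    · exact (continuous_const.sub (hG.continuous_left z)).abs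
  simpa using h.tendsto x

theorem abs_integral_sub_le [IsFiniteMeasure μ] (hG : IsBoundedKernel G C) {v : X → ℝ}
    (hv : Measurable v) (hB : ∀ z, |v z| ≤ 1) (x y : X) :
    |(∫ z, G x z * v z ∂μ) - ∫ z, G y z * v z ∂μ| ≤ ∫ z, |G x z - G y z| ∂μ := by
  rw [← integral_sub (hG.integrable_mul hv hB x) (hG.integrable_mul hv hB y)]
  refine (MeasureTheory.abs_integral_le_integral_abs).trans (integral_mono_of_nonneg
    (Eventually.of_forall fun z => abs_nonneg _) ?_ (Eventually.of_forall fun z => ?_))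
  · have h1 : ∀ z : X, |(fun _ => (1 : ℝ)) z| ≤ 1 := fun z => by simp
    have := (hG.integrable_mul (μ := μ) measurable_const h1 x).sub
      (hG.integrable_mul (μ := μ) measurable_const h1 y)
    simpa using this.abs
  · simp only
    rw [← sub_mul, abs_mul]
    exact mul_le_of_le_one_right (abs_nonneg _) (hB z)

theorem integral_mono_right [IsFiniteMeasure μ] (hG : IsBoundedKernel G C) {v w : X → ℝ}
    (hv : Measurable v) (hw : Measurable w) {B B' : ℝ} (hB : ∀ z, |v z| ≤ B)
    (hB' : ∀ z, |w z| ≤ B') (hvw : ∀ z, v z ≤ w z) (x : X) :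
    ∫ z, G x z * v z ∂μ ≤ ∫ z, G x z * w z ∂μ :=
  integral_mono (hG.integrable_mul hv hB x) (hG.integrable_mul hw hB' x)
    fun z => mul_le_mul_of_nonneg_left (hvw z) (hG.nonneg x z)

theorem integral_nonneg_right (hG : IsBoundedKernel G C) {v : X → ℝ}
    (hv : ∀ z, 0 ≤ v z) (x : X) : 0 ≤ ∫ z, G x z * v z ∂μ :=
  integral_nonneg fun z => mul_nonneg (hG.nonneg x z) (hv z)

/-- The inhomogeneous equation `v = 1 + lam * ∫ G v` is solvable as soon as it has a
nonnegative supersolution. -/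
theorem exists_solution_of_supersolution [FirstCountableTopology X] [CompactSpace X]
    [OpensMeasurableSpace X] [IsFiniteMeasure μ]
    (hG : IsBoundedKernel G C) {lam : ℝ} (hlam : 0 ≤ lam) {V : C(X, ℝ)} (hV0 : ∀ x, 0 ≤ V x)
    (hV : ∀ x, 1 + lam * ∫ z, G x z * V z ∂μ ≤ V x) :
    ∃ v : C(X, ℝ), (∀ x, 0 ≤ v x) ∧ ∀ x, v x = 1 + lam * ∫ z, G x z * v z ∂μ := by
  have hmeas : ∀ v : C(X, ℝ), Measurable v := fun v => v.continuous.measurable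
  have hbd : ∀ (v : C(X, ℝ)) z, |v z| ≤ ‖v‖ := fun v z => v.norm_coe_le_norm z
  let step : C(X, ℝ) → C(X, ℝ) := fun v =>
    ⟨fun x => 1 + lam * ∫ z, G x z * v z ∂μ,
      continuous_const.add (continuous_const.mul (hG.continuous_integral (hmeas v) (hbd v)))⟩
  have step_mono : ∀ v w : C(X, ℝ), (∀ x, v x ≤ w x) → ∀ x, step v x ≤ step w x := by
    intro v w h x
    have := hG.integral_mono_right (μ := μ) (hmeas v) (hmeas w) (hbd v) (hbd w) h x
    exact add_le_add le_rfl (mul_le_mul_of_nonneg_left this hlam)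
  let v : ℕ → C(X, ℝ) := fun n => step^[n] 0
  have hsucc : ∀ n, v (n + 1) = step (v n) := fun n => Function.iterate_succ_apply' step n 0
  have hle : ∀ n x, v n x ≤ V x := by
    intro n
    induction n with
    | zero => exact hV0
    | succ n ih =>
      intro x
      rw [hsucc]
      exact (step_mono _ _ ih x).trans (hV x)
  have hmono : ∀ n x, v n x ≤ v (n + 1) x := by
    intro n
    induction n with
    | zero =>
      intro x
      have := hG.integral_nonneg_right (μ := μ) (v := (0 : C(X, ℝ))) (fun _ => le_rfl) x
      change 0 ≤ 1 + lam * _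
      have := mul_nonneg hlam this
      linarith
    | succ n ih =>
      intro x
      rw [hsucc, hsucc (n + 1)]
      exact step_mono _ _ ih x
  have hmono' : ∀ x, Monotone fun n => v n x := fun x => monotone_nat_of_le_succ fun n => hmono n x
  have h0 : ∀ n x, 0 ≤ v n x := fun n x => hmono' x (Nat.zero_le n)
  let g : X → ℝ := fun x => ⨆ n, v n x
  have hlim : ∀ x, Tendsto (fun n => v n x) atTop (nhds (g x)) := fun x =>
    tendsto_atTop_ciSup (hmono' x) ⟨V x, by rintro _ ⟨n, rfl⟩; exact hle n x⟩
  have hgm : Measurable g :=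
    measurable_of_tendsto_metrizable (fun n => hmeas (v n)) (tendsto_pi_nhds.2 hlim)
  have hg0 : ∀ x, 0 ≤ g x := fun x => ge_of_tendsto' (hlim x) fun n => h0 n x
  have hgV : ∀ x, g x ≤ V x := fun x => le_of_tendsto' (hlim x) fun n => hle n x
  have hvB : ∀ n x, |v n x| ≤ ‖V‖ := fun n x => by
    rw [abs_of_nonneg (h0 n x)]; exact (hle n x).trans ((le_abs_self _).trans (hbd V x))
  have hgB : ∀ x, |g x| ≤ ‖V‖ := fun x => by
    rw [abs_of_nonneg (hg0 x)]; exact (hgV x).trans ((le_abs_self _).trans (hbd V x))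
  have hfix : ∀ x, g x = 1 + lam * ∫ z, G x z * g z ∂μ := by
    intro x
    refine tendsto_nhds_unique ((tendsto_add_atTop_iff_nat 1).2 (hlim x)) ?_
    have : Tendsto (fun n => ∫ z, G x z * v n z ∂μ) atTop (nhds (∫ z, G x z * g z ∂μ)) :=
      tendsto_integral_of_dominated_convergence (fun _ => C * ‖V‖)
        (fun n => ((hG.measurable_right x).mul (hmeas (v n))).aestronglyMeasurable)
        (integrable_const _) (fun n => Eventually.of_forall (hG.abs_mul_le (hvB n) x))
        (Eventually.of_forall fun z => (hlim z).const_mul _)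
    simp only [hsucc]
    exact (this.const_mul lam).const_add 1
  refine ⟨⟨g, ?_⟩, hg0, hfix⟩
  rw [show g = fun x => 1 + lam * ∫ z, G x z * g z ∂μ from funext hfix]
  exact continuous_const.add (continuous_const.mul (hG.continuous_integral hgm hgB))

/-- The integral operator of a bounded kernel is compact on continuous functions. -/
theorem exists_tendsto_subseq [FirstCountableTopology X] [CompactSpace X]
    [OpensMeasurableSpace X] [IsFiniteMeasure μ] (hG : IsBoundedKernel G C)
    {T : C(X, ℝ) → C(X, ℝ)} (hT : ∀ v x, T v x = ∫ z, G x z * v z ∂μ)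
    {w : ℕ → C(X, ℝ)} (hw : ∀ n, ‖w n‖ ≤ 1) :
    ∃ (y : C(X, ℝ)) (φ : ℕ → ℕ), StrictMono φ ∧
      Tendsto (fun n => T (w (φ n))) atTop (nhds y) := by
  have hmeas : ∀ v : C(X, ℝ), Measurable v := fun v => v.continuous.measurable
  have hwB : ∀ n z, |w n z| ≤ 1 := fun n z => ((w n).norm_coe_le_norm z).trans (hw n)
  let e := ContinuousMap.linearIsometryBoundedOfCompact X ℝ ℝ
  have hcompact : IsCompact (closure (range fun n => e (T (w n)))) := by
    refine BoundedContinuousFunction.arzela_ascoli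
      (Metric.closedBall 0 (C * 1 * μ.real univ)) (isCompact_closedBall _ _) _ ?_ ?_
    · rintro _ x ⟨n, rfl⟩
      rw [mem_closedBall_zero_iff]
      change ‖T (w n) x‖ ≤ _
      rw [hT]
      exact norm_integral_le_of_norm_le_const (Eventually.of_forall (hG.abs_mul_le (hwB n) x))
    · intro x
      refine Metric.equicontinuousAt_of_continuity_modulus _
        (hG.tendsto_integral_abs_sub (μ := μ) x) _ (Eventually.of_forall fun y => ?_)
      rintro ⟨_, n, rfl⟩
      change dist (T (w n) x) (T (w n) y) ≤ _
      rw [hT, hT]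
      exact hG.abs_integral_sub_le (hmeas _) (hwB n) x y
  obtain ⟨y, -, φ, hφ, hy⟩ := hcompact.tendsto_subseq (x := fun n => e (T (w n)))
    fun n => subset_closure ⟨n, rfl⟩
  refine ⟨e.symm y, φ, hφ, ?_⟩
  have := (e.symm.continuous.tendsto y).comp hy
  simpa [Function.comp_def] using this

/-- A positive eigenfunction of a bounded kernel which is nondegenerate on some set. -/
theorem exists_eigenfunction [FirstCountableTopology X] [CompactSpace X]
    [OpensMeasurableSpace X] [IsFiniteMeasure μ]
    (hG : IsBoundedKernel G C) {c : ℝ} (hc : 0 < c) {M : Set X} (hM : MeasurableSet M)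
    (hμM : μ M ≠ 0) (hGM : ∀ x ∈ M, ∀ z ∈ M, c ≤ G x z) :
    ∃ lam : ℝ, 0 < lam ∧ ∃ w : C(X, ℝ), (∀ x, 0 ≤ w x) ∧ w ≠ 0 ∧
      ∀ x, w x = lam * ∫ z, G x z * w z ∂μ := by
  have hmeas : ∀ v : C(X, ℝ), Measurable v := fun v => v.continuous.measurable
  have hbd : ∀ (v : C(X, ℝ)) z, |v z| ≤ ‖v‖ := fun v z => v.norm_coe_le_norm z
  let T : C(X, ℝ) → C(X, ℝ) := fun v =>
    ⟨fun x => ∫ z, G x z * v z ∂μ, hG.continuous_integral (hmeas v) (hbd v)⟩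
  have T_apply : ∀ v x, T v x = ∫ z, G x z * v z ∂μ := fun _ _ => rfl
  have T_smul : ∀ (a : ℝ) v, T (a • v) = a • T v := by
    intro a v
    ext x
    simp only [T_apply, ContinuousMap.smul_apply, smul_eq_mul, ← MeasureTheory.integral_const_mul]
    exact integral_congr_ae (Eventually.of_forall fun z => by ring)
  have T_nonneg : ∀ v : C(X, ℝ), (∀ x, 0 ≤ v x) → ∀ x, 0 ≤ T v x := fun v hv x =>
    hG.integral_nonneg_right hv x
  have T_le : ∀ (v : C(X, ℝ)), ∀ x, |T v x| ≤ C * ‖v‖ * μ.real univ := fun v x =>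
    norm_integral_le_of_norm_le_const (Eventually.of_forall (hG.abs_mul_le (hbd v) x))
  have hmM : 0 < μ.real M := ENNReal.toReal_pos hμM (measure_ne_top μ M)
  obtain ⟨x₀, hx₀⟩ : M.Nonempty := nonempty_of_measure_ne_zero hμM
  have hC : 0 < C := hc.trans_le ((hGM x₀ hx₀ x₀ hx₀).trans (hG.le _ _))
  -- the set of parameters admitting a supersolution
  let A : Set ℝ := {lam | 0 ≤ lam ∧ ∃ v : C(X, ℝ), (∀ x, 0 ≤ v x) ∧ ∀ x, 1 + lam * T v x ≤ v x}
  have hA0 : (0 : ℝ) ∈ A := ⟨le_rfl, 1, fun x => by simp, fun x => by simp⟩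
  have hAsol : ∀ lam ∈ A, ∃ v : C(X, ℝ), (∀ x, 0 ≤ v x) ∧ ∀ x, v x = 1 + lam * T v x := by
    rintro lam ⟨h0, v, hv0, hv⟩
    exact hG.exists_solution_of_supersolution h0 hv0 hv
  have hAbdd : ∀ lam ∈ A, lam ≤ 1 / (c * μ.real M) := by
    intro lam hlam
    have h0 := hlam.1
    obtain ⟨v, hv0, hv⟩ := hAsol lam hlam
    have hvi : Integrable v μ := Integrable.of_bound (hmeas v).aestronglyMeasurable ‖v‖
      (Eventually.of_forall (hbd v))
    set I := ∫ z in M, v z ∂μ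
    have hlow : ∀ x ∈ M, c * I ≤ T v x := by
      intro x hx
      calc c * I = ∫ z in M, c * v z ∂μ := (MeasureTheory.integral_const_mul _ _).symm
        _ ≤ ∫ z in M, G x z * v z ∂μ :=
          setIntegral_mono_on (hvi.const_mul c).integrableOn
            (hG.integrable_mul (hmeas v) (hbd v) x).integrableOn hM
            fun z hz => mul_le_mul_of_nonneg_right (hGM x hx z hz) (hv0 z)
        _ ≤ T v x := setIntegral_le_integral (hG.integrable_mul (hmeas v) (hbd v) x)
            (Eventually.of_forall fun z => mul_nonneg (hG.nonneg x z) (hv0 z))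
    have hI : (1 + lam * (c * I)) * μ.real M ≤ I := by
      have : ∫ z in M, (1 + lam * (c * I)) ∂μ ≤ I :=
        setIntegral_mono_on (integrable_const _).integrableOn hvi.integrableOn hM fun x hx => by
          rw [hv x]
          exact add_le_add le_rfl (mul_le_mul_of_nonneg_left (hlow x hx) h0)
      simpa [mul_comm] using this
    have hI0 : 0 ≤ I := integral_nonneg hv0
    have hIpos : 0 < I := by
      refine lt_of_lt_of_le (mul_pos ?_ hmM) hI
      have : 0 ≤ lam * (c * I) := by positivity
      linarith
    rw [le_div_iff₀ (by positivity)]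
    by_contra hcon
    push Not at hcon
    nlinarith
  have hAB : BddAbove A := ⟨_, hAbdd⟩
  set L := sSup A with hLdef
  let D : ℝ := 2 * (C * μ.real univ)
  have hopen : ∀ lam ∈ A, ∀ v : C(X, ℝ), (∀ x, 0 ≤ v x) → (∀ x, v x = 1 + lam * T v x) →
      1 / (D * ‖v‖ + 1) ≤ L - lam := by
    intro lam hlam v hv0 hv
    have hD : 0 ≤ D * ‖v‖ := by positivity
    have : lam + 1 / (D * ‖v‖ + 1) ∈ A := by
      refine ⟨add_nonneg hlam.1 (by positivity), (2 : ℝ) • v, fun x => ?_, fun x => ?_⟩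
      · simpa using hv0 x
      · rw [T_smul]
        simp only [ContinuousMap.smul_apply, smul_eq_mul]
        have h1 := hv x
        have h2 : T v x * 2 ≤ D * ‖v‖ + 1 := by
          have := (le_abs_self _).trans (T_le v x)
          simp only [D]; linarith
        have h3 : 1 / (D * ‖v‖ + 1) * (2 * T v x) ≤ 1 := by
          rw [one_div_mul_eq_div, div_le_one (by positivity)]; linarith
        linarith
    have := le_csSup hAB this
    linarith
  obtain ⟨lam, -, hlamL, hlamA⟩ := exists_seq_tendsto_sSup ⟨0, hA0⟩ hAB
  choose v hv0 hv using fun n => hAsol (lam n) (hlamA n)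
  have hvne : ∀ n, 0 < ‖v n‖ := fun n => by
    have h1 := hv n x₀
    have h2 := mul_nonneg (hlamA n).1 (T_nonneg _ (hv0 n) x₀)
    have := (le_abs_self _).trans (hbd (v n) x₀)
    linarith
  have hvinv : Tendsto (fun n => ‖v n‖⁻¹) atTop (nhds 0) := by
    have hz : Tendsto (fun n => (D + 1) * (L - lam n) + (L - lam n)) atTop (nhds 0) := by
      have : Tendsto (fun n => L - lam n) atTop (nhds 0) := by
        simpa [← hLdef] using hlamL.const_sub L
      simpa using (this.const_mul (D + 1)).add this
    refine squeeze_zero (fun n => (inv_pos.2 (hvne n)).le) (fun n => ?_) hz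
    have h1 := hopen _ (hlamA n) (v n) (hv0 n) (hv n)
    have hone : 1 ≤ ‖v n‖ := by
      have h1 := hv n x₀
      have h2 := mul_nonneg (hlamA n).1 (T_nonneg _ (hv0 n) x₀)
      have := (le_abs_self _).trans (hbd (v n) x₀)
      linarith
    have hD : 0 ≤ D := by positivity
    have h2 : ‖v n‖⁻¹ ≤ (D + 1) * (1 / (D * ‖v n‖ + 1)) := by
      rw [mul_one_div, inv_le_iff_one_le_mul₀ (hvne n), div_mul_eq_mul_div,
        le_div_iff₀ (by nlinarith)]
      nlinarith
    have h3 : 0 ≤ L - lam n := le_trans (by positivity) h1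
    have h4 := mul_le_mul_of_nonneg_left h1 (by positivity : 0 ≤ D + 1)
    linarith
  let w : ℕ → C(X, ℝ) := fun n => ‖v n‖⁻¹ • v n
  have hw1 : ∀ n, ‖w n‖ = 1 := fun n => by
    rw [norm_smul, norm_inv, norm_norm, inv_mul_cancel₀ (hvne n).ne']
  have hw0 : ∀ n x, 0 ≤ w n x := fun n x => mul_nonneg (inv_nonneg.2 (norm_nonneg _)) (hv0 n x)
  have hw : ∀ n, w n = ‖v n‖⁻¹ • (1 : C(X, ℝ)) + lam n • T (w n) := by
    intro n
    rw [T_smul]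
    ext x
    simp only [w, ContinuousMap.smul_apply, ContinuousMap.add_apply, smul_eq_mul,
      ContinuousMap.one_apply]
    conv_lhs => rw [hv n x]
    ring
  obtain ⟨y, φ, hφ, hy⟩ := hG.exists_tendsto_subseq T_apply fun n => (hw1 n).le
  have hwlim : Tendsto (fun n => w (φ n)) atTop (nhds (L • y)) := by
    have h1 := (hvinv.comp hφ.tendsto_atTop).smul_const (1 : C(X, ℝ))
    have h2 := (hlamL.comp hφ.tendsto_atTop).smul hy
    have h3 := h1.add h2
    rw [zero_smul, zero_add] at h3
    refine h3.congr fun n => ?_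
    exact (hw (φ n)).symm
  have hpt : ∀ x, Tendsto (fun n => w (φ n) x) atTop (nhds ((L • y) x)) := fun x =>
    ((continuous_eval_const x).tendsto _).comp hwlim
  have hTy : T (L • y) = y := by
    ext x
    refine tendsto_nhds_unique ?_ (((continuous_eval_const x).tendsto _).comp hy)
    exact tendsto_integral_of_dominated_convergence (fun _ => C * 1)
      (fun n => ((hG.measurable_right x).mul (hmeas _)).aestronglyMeasurable)
      (integrable_const _)
      (fun n => Eventually.of_forall (hG.abs_mul_le (fun z => (hbd _ z).trans (hw1 _).le) x))
      (Eventually.of_forall fun z => (hpt z).const_mul _)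
  have hnorm : ‖L • y‖ = 1 :=
    tendsto_nhds_unique hwlim.norm (by simp [hw1])
  have hne : L • y ≠ 0 := fun h => by simp [h] at hnorm
  have hL : 0 ≤ L := le_csSup hAB hA0
  refine ⟨L, hL.lt_of_ne fun h => hne (by rw [← h, zero_smul]), L • y,
    fun x => ge_of_tendsto' (hpt x) fun n => hw0 _ x, hne, fun x => ?_⟩
  rw [← T_apply, hTy]; rfl

end IsBoundedKernel

/-- A positive eigenfunction `u` of `L_k` for the eigenvalue `lam`, together with its flux
`V = f * u'`. -/
structure IsGroundState (f : ℝ → ℝ) (k : ℕ) (lam : ℝ) (u V : ℝ → ℝ) : Prop where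
  contOn : ContinuousOn u (Icc (-1) 1)
  pos : ∀ x ∈ Ioo (-1 : ℝ) 1, 0 < u x
  boundary : 1 ≤ k → u (-1) = 0 ∧ u 1 = 0
  hasDerivAt : ∀ x ∈ Ioo (-1 : ℝ) 1, HasDerivAt u (V x / f x) x
  hasDerivAt_flux : ∀ x ∈ Ioo (-1 : ℝ) 1, HasDerivAt V ((k : ℝ) ^ 2 / f x * u x - lam * u x) x
  abs_flux_le : ∀ x ∈ Ioo (-1 : ℝ) 1, |V x| ≤ k * u x

theorem isGroundState_zero (f : ℝ → ℝ) : IsGroundState f 0 0 (fun _ => 1) (fun _ => 0) where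
  contOn := continuousOn_const
  pos := by simp
  boundary := by simp
  hasDerivAt x _ := by simpa using hasDerivAt_const x (1 : ℝ)
  hasDerivAt_flux x _ := by simpa using hasDerivAt_const x (0 : ℝ)
  abs_flux_le := by simp

/-- Two functions forming a linear first order system with smooth coefficients are smooth. -/
theorem contDiffOn_of_hasDerivAt_system {s : Set ℝ} (hs : IsOpen s) {u V a b : ℝ → ℝ}
    (ha : ContDiffOn ℝ (⊤ : ℕ∞) a s) (hb : ContDiffOn ℝ (⊤ : ℕ∞) b s)
    (hu : ∀ x ∈ s, HasDerivAt u (a x * V x) x) (hV : ∀ x ∈ s, HasDerivAt V (b x * u x) x) :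
    ContDiffOn ℝ (⊤ : ℕ∞) u s := by
  have key : ∀ n : ℕ, ContDiffOn ℝ n u s ∧ ContDiffOn ℝ n V s := by
    intro n
    induction n with
    | zero =>
      simp only [Nat.cast_zero, contDiffOn_zero]
      exact ⟨fun x hx => (hu x hx).continuousAt.continuousWithinAt,
        fun x hx => (hV x hx).continuousAt.continuousWithinAt⟩
    | succ n ih =>
      have hn : (n : WithTop ℕ∞) ≤ ((⊤ : ℕ∞) : WithTop ℕ∞) := by exact_mod_cast le_top
      simp only [Nat.cast_succ]
      rw [contDiffOn_succ_iff_deriv_of_isOpen hs, contDiffOn_succ_iff_deriv_of_isOpen hs]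
      refine ⟨⟨fun x hx => (hu x hx).differentiableAt.differentiableWithinAt, by simp, ?_⟩,
        ⟨fun x hx => (hV x hx).differentiableAt.differentiableWithinAt, by simp, ?_⟩⟩
      · exact ((ha.of_le hn).mul ih.2).congr fun x hx => (hu x hx).deriv
      · exact ((hb.of_le hn).mul ih.1).congr fun x hx => (hV x hx).deriv
  exact contDiffOn_infty.2 fun n => (key n).1

namespace IsGroundState

variable {f u V : ℝ → ℝ} {k : ℕ} {lam : ℝ}

theorem inSpec (h : IsGroundState f k lam u V) (hf : IsProfile f) : InSpec f k lam := by
  have hne : ∀ x ∈ Ioo (-1 : ℝ) 1, f x ≠ 0 := fun x hx => (hf.pos x hx).ne'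
  refine ⟨u, h.contOn, ?_, ⟨0, by norm_num, (h.pos 0 (by norm_num)).ne'⟩, h.boundary, ?_⟩
  · refine contDiffOn_of_hasDerivAt_system isOpen_Ioo (a := fun x => (f x)⁻¹) (V := V)
      (b := fun x => (k : ℝ) ^ 2 * (f x)⁻¹ - lam) (hf.smoothOn.inv hne)
      ((contDiffOn_const.mul (hf.smoothOn.inv hne)).sub contDiffOn_const) ?_ ?_
    · intro x hx
      convert! h.hasDerivAt x hx using 1
      ring
    · intro x hx
      convert! h.hasDerivAt_flux x hx using 1
      ring
  · intro x hx
    have : (fun y => f y * deriv u y) =ᶠ[nhds x] V := by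
      filter_upwards [isOpen_Ioo.mem_nhds hx] with y hy
      rw [(h.hasDerivAt y hy).deriv, mul_div_cancel₀ _ (hne y hy)]
    rw [this.deriv_eq, (h.hasDerivAt_flux x hx).deriv]
    ring

/-- Ground states of distinct operators have distinct eigenvalues. -/
theorem ne_of_lt (h : IsGroundState f k lam u V) (hf : IsProfile f) {k' : ℕ} {lam' : ℝ}
    {u' V' : ℝ → ℝ} (h' : IsGroundState f k' lam' u' V') (hk : k < k') : lam ≠ lam' := by
  rintro rfl
  obtain ⟨hl, hr⟩ := h'.boundary (Nat.one_le_of_lt hk)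
  let W : ℝ → ℝ := fun x => if x ∈ Ioo (-1 : ℝ) 1 then V x * u' x - u x * V' x else 0
  have hWeq : ∀ x ∈ Ioo (-1 : ℝ) 1, W x = V x * u' x - u x * V' x := fun x hx => if_pos hx
  have hW : ∀ x ∈ Ioo (-1 : ℝ) 1,
      HasDerivAt W (((k : ℝ) ^ 2 - (k' : ℝ) ^ 2) * (u x * u' x / f x)) x := by
    intro x hx
    have hfx := (hf.pos x hx).ne'
    have h1 := ((h.hasDerivAt_flux x hx).mul (h'.hasDerivAt x hx)).sub
      ((h.hasDerivAt x hx).mul (h'.hasDerivAt_flux x hx))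
    have h2 : W =ᶠ[nhds x] (V * u' - u * V') := by
      filter_upwards [isOpen_Ioo.mem_nhds hx] with y hy using hWeq y hy
    refine HasDerivAt.congr_of_eventuallyEq ?_ h2
    convert! h1 using 1
    field_simp
    ring
  have hbound : ∀ x ∈ Icc (-1 : ℝ) 1, |W x| ≤ ((k : ℝ) + k') * |u x * u' x| := by
    intro x hx
    by_cases hxo : x ∈ Ioo (-1 : ℝ) 1
    · rw [hWeq x hxo]
      have p := h.pos x hxo
      have p' := h'.pos x hxo
      have a := h.abs_flux_le x hxo
      have a' := h'.abs_flux_le x hxo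
      rw [abs_of_pos (mul_pos p p')]
      calc |V x * u' x - u x * V' x| ≤ |V x * u' x| + |u x * V' x| := abs_sub _ _
        _ = |V x| * u' x + u x * |V' x| := by rw [abs_mul, abs_mul, abs_of_pos p, abs_of_pos p']
        _ ≤ (k * u x) * u' x + u x * (k' * u' x) := by gcongr
        _ = _ := by ring
    · simp only [W, if_neg hxo, abs_zero]
      positivity
  have hend : ∀ x ∈ Icc (-1 : ℝ) 1, x ∉ Ioo (-1 : ℝ) 1 → u x * u' x = 0 := by
    intro x hx hxo
    rcases eq_or_lt_of_le hx.1 with h1 | h1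
    · rw [← h1, hl, mul_zero]
    · rcases eq_or_lt_of_le hx.2 with h2 | h2
      · rw [h2, hr, mul_zero]
      · exact absurd ⟨h1, h2⟩ hxo
  have hWc : ContinuousOn W (Icc (-1) 1) := by
    intro x hx
    by_cases hxo : x ∈ Ioo (-1 : ℝ) 1
    · exact (hW x hxo).continuousAt.continuousWithinAt
    · have hWx : W x = 0 := if_neg hxo
      rw [ContinuousWithinAt, hWx]
      have hlim : Tendsto (fun y => ((k : ℝ) + k') * |u y * u' y|) (nhdsWithin x (Icc (-1) 1))
          (nhds 0) := by
        have := ((h.contOn.mul h'.contOn).abs x hx).tendsto.const_mul ((k : ℝ) + k')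
        simpa only [Pi.mul_apply, hend x hx hxo, abs_zero, mul_zero] using this
      exact squeeze_zero_norm' (eventually_mem_nhdsWithin.mono fun y hy => hbound y hy) hlim
  have hanti : StrictAntiOn W (Icc (-1) 1) := by
    refine strictAntiOn_of_deriv_neg (convex_Icc _ _) hWc fun x hx => ?_
    rw [interior_Icc] at hx
    rw [(hW x hx).deriv]
    have : (k : ℝ) < k' := by exact_mod_cast hk
    have hk0 : (0 : ℝ) ≤ k := by positivity
    refine mul_neg_of_neg_of_pos (by nlinarith)
      (div_pos (mul_pos (h.pos x hx) (h'.pos x hx)) (hf.pos x hx))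
  have := hanti (left_mem_Icc.2 (by norm_num)) (right_mem_Icc.2 (by norm_num))
    (by norm_num : (-1 : ℝ) < 1)
  simp [W] at this

/-- Picone's inequality for a ground state and the test function `f ^ (l / 2)`. -/
theorem mul_integral_pow_le (h : IsGroundState f k lam u V) (hf : IsProfile f)
    (hf' : ContinuousOn (deriv f) (Icc (-1) 1)) {l : ℕ} (hl : 1 ≤ l)
    (hint : IntervalIntegrable (fun x => f x ^ l * deriv (deriv f) x) volume (-1) 1) :
    lam * (∫ x in (-1 : ℝ)..1, f x ^ l) ≤ (k : ℝ) ^ 2 * (∫ x in (-1 : ℝ)..1, f x ^ (l - 1))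
      - (l : ℝ) / 4 * ∫ x in (-1 : ℝ)..1, f x ^ l * deriv (deriv f) x := by
  obtain ⟨n, rfl⟩ : ∃ n, l = n + 1 := ⟨l - 1, by omega⟩
  rw [Nat.add_sub_cancel]
  have hpi : ∀ j : ℕ, IntervalIntegrable (fun x => f x ^ j) volume (-1) 1 := fun j =>
    (show ContinuousOn (fun x => f x ^ j) (uIcc (-1) 1) by
      rw [uIcc_of_le (by norm_num)]; exact hf.contOn.pow j).intervalIntegrable
  let L : ℝ := (n + 1 : ℕ)
  let P : ℝ → ℝ := fun x => V x / u x * f x ^ (n + 1)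
  let Q : ℝ → ℝ := fun x => if x ∈ Ioo (-1 : ℝ) 1 then P x else 0
  let Φ : ℝ → ℝ := fun x => L / 4 * (f x ^ (n + 1) * deriv f x) - Q x
  let ψ : ℝ → ℝ := fun x => L / 4 * (f x ^ (n + 1) * deriv (deriv f) x)
    - (k : ℝ) ^ 2 * f x ^ n + lam * f x ^ (n + 1)
  have hfd : ∀ x ∈ Ioo (-1 : ℝ) 1, HasDerivAt f (deriv f x) x := fun x hx =>
    ((hf.smoothOn.contDiffAt (isOpen_Ioo.mem_nhds hx)).differentiableAt (by simp)).hasDerivAt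
  have hfdd : ∀ x ∈ Ioo (-1 : ℝ) 1, HasDerivAt (deriv f) (deriv (deriv f) x) x := by
    intro x hx
    have := ((contDiffOn_infty_iff_deriv_of_isOpen isOpen_Ioo).1 hf.smoothOn).2
    exact ((this.contDiffAt (isOpen_Ioo.mem_nhds hx)).differentiableAt (by simp)).hasDerivAt
  have hP : ∀ x ∈ Ioo (-1 : ℝ) 1, HasDerivAt P
      (((k : ℝ) ^ 2 / f x - lam - (V x / u x) ^ 2 / f x) * f x ^ (n + 1)
        + V x / u x * (L * f x ^ n * deriv f x)) x := by
    intro x hx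
    have hfx := (hf.pos x hx).ne'
    have hux := (h.pos x hx).ne'
    have h1 := ((h.hasDerivAt_flux x hx).div (h.hasDerivAt x hx) hux).mul ((hfd x hx).pow (n + 1))
    convert! h1 using 1
    simp only [Pi.div_apply, Pi.pow_apply, Nat.add_sub_cancel, L]
    field_simp
  have hQc : ContinuousOn Q (Icc (-1) 1) := by
    intro x hx
    by_cases hxo : x ∈ Ioo (-1 : ℝ) 1
    · refine ContinuousAt.continuousWithinAt ?_
      refine (hP x hxo).continuousAt.congr ?_
      filter_upwards [isOpen_Ioo.mem_nhds hxo] with y hy using (if_pos hy).symm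
    · have hQx : Q x = 0 := if_neg hxo
      have hfx : f x = 0 := by
        rcases eq_or_lt_of_le hx.1 with h1 | h1
        · rw [← h1, hf.zero_neg_one]
        · rcases eq_or_lt_of_le hx.2 with h2 | h2
          · rw [h2, hf.zero_one]
          · exact absurd ⟨h1, h2⟩ hxo
      rw [ContinuousWithinAt, hQx]
      have hlim : Tendsto (fun y => (k : ℝ) * |f y ^ (n + 1)|) (nhdsWithin x (Icc (-1) 1))
          (nhds 0) := by
        have := ((hf.contOn.pow (n + 1)).abs x hx).tendsto.const_mul (k : ℝ)
        simpa [hfx] using this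
      refine squeeze_zero_norm' (eventually_mem_nhdsWithin.mono fun y hy => ?_) hlim
      by_cases hyo : y ∈ Ioo (-1 : ℝ) 1
      · have hu := h.pos y hyo
        simp only [Q, if_pos hyo, P]
        rw [norm_mul, norm_div, Real.norm_of_nonneg hu.le]
        refine mul_le_mul_of_nonneg_right ?_ (abs_nonneg _)
        rw [div_le_iff₀ hu]
        exact h.abs_flux_le y hyo
      · simp only [Q, if_neg hyo, norm_zero]
        positivity
  have hΦc : ContinuousOn Φ (Icc (-1) 1) :=
    (continuousOn_const.mul ((hf.contOn.pow (n + 1)).mul hf')).sub hQc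
  have hΦ : ∀ x ∈ Ioo (-1 : ℝ) 1, HasDerivAt Φ
      (ψ x + f x ^ n * (L / 2 * deriv f x - V x / u x) ^ 2) x := by
    intro x hx
    have hfx := (hf.pos x hx).ne'
    have h1 := ((((hfd x hx).pow (n + 1)).mul (hfdd x hx)).const_mul (L / 4)).sub (hP x hx)
    refine HasDerivAt.congr_of_eventuallyEq (f := fun x => L / 4 * (f x ^ (n + 1) * deriv f x) - P x)
      ?_ ?_
    · convert! h1 using 1
      simp only [ψ, L, Pi.pow_apply, Nat.add_sub_cancel]
      field_simp
      ring
    · filter_upwards [isOpen_Ioo.mem_nhds hx] with y hy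
      simp only [Φ, Q, if_pos hy]
  have hi1 := hint.const_mul (L / 4)
  have hi2 := (hpi n).const_mul ((k : ℝ) ^ 2)
  have hi3 := (hpi (n + 1)).const_mul lam
  have hψi : IntervalIntegrable ψ volume (-1) 1 := (hi1.sub hi2).add hi3
  have hle : ∫ x in (-1 : ℝ)..1, ψ x ≤ Φ 1 - Φ (-1) := by
    refine integral_le_sub_of_hasDeriv_right_of_le (by norm_num) hΦc
      (fun x hx => (hΦ x hx).hasDerivWithinAt) ?_ fun x hx => ?_
    · exact (intervalIntegrable_iff_integrableOn_Icc_of_le (by norm_num)).1 hψi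
    · have := pow_pos (hf.pos x hx) n
      exact le_add_of_nonneg_right (by positivity)
  have hΦ1 : Φ 1 - Φ (-1) = 0 := by simp [Φ, Q, hf.zero_one, hf.zero_neg_one]
  have hψ : ∫ x in (-1 : ℝ)..1, ψ x
      = L / 4 * (∫ x in (-1 : ℝ)..1, f x ^ (n + 1) * deriv (deriv f) x)
        - (k : ℝ) ^ 2 * (∫ x in (-1 : ℝ)..1, f x ^ n)
        + lam * ∫ x in (-1 : ℝ)..1, f x ^ (n + 1) := by
    simp only [ψ]
    rw [intervalIntegral.integral_add (hi1.sub hi2) hi3, intervalIntegral.integral_sub hi1 hi2]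
    simp only [intervalIntegral.integral_const_mul]
  rw [hΦ1, hψ] at hle
  simp only [L] at hle
  linarith

end IsGroundState

/-- A primitive of `1 / f` is unbounded above near a simple zero of `f`. -/
theorem tendsto_atTop_of_hasDerivAt_inv {f s : ℝ → ℝ} (hpos : ∀ x ∈ Ioo (-1 : ℝ) 1, 0 < f x)
    (h1 : f 1 = 0) (hd : HasDerivAt f (-2) 1)
    (hs : ∀ x ∈ Ioo (-1 : ℝ) 1, HasDerivAt s (1 / f x) x) :
    Tendsto s (nhdsWithin 1 (Iio 1)) atTop := by
  have hslope : ∀ᶠ y in nhdsWithin (1 : ℝ) (Iio 1), f y < 3 * (1 - y) := by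
    have h2 : Tendsto (slope f 1) (nhdsWithin 1 (Iio 1)) (nhds (-2)) :=
      (hasDerivAt_iff_tendsto_slope.1 hd).mono_left
        (nhdsWithin_mono _ fun y (hy : y < 1) => hy.ne)
    filter_upwards [h2.eventually (lt_mem_nhds (by norm_num : (-3 : ℝ) < -2)),
      self_mem_nhdsWithin] with y hy hy1
    have hy1 : y < 1 := hy1
    rw [slope_def_field, h1, sub_zero, lt_div_iff_of_neg (by linarith)] at hy
    linarith
  obtain ⟨a, ha, hab⟩ := (mem_nhdsLT_iff_exists_Ioo_subset).1 hslope
  have ha : a < 1 := ha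
  let b := (max a 0 + 1) / 2
  have hmax : max a 0 < 1 := max_lt ha one_pos
  have hba : a < b := by have := le_max_left a 0; simp only [b]; linarith
  have hb0 : 0 < b := by have := le_max_right a 0; simp only [b]; linarith
  have hb1 : b < 1 := by simp only [b]; linarith
  let D : ℝ → ℝ := fun y => s y + 1 / 3 * Real.log (1 - y)
  have hD : ∀ y ∈ Ico b 1, HasDerivAt D (1 / f y + 1 / 3 * (-1 / (1 - y))) y := by
    intro y hy
    refine (hs y ⟨by linarith [hy.1], hy.2⟩).add (HasDerivAt.const_mul _ ?_)
    exact ((hasDerivAt_id y).const_sub 1).log (by simpa using (sub_pos.2 hy.2).ne')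
  have hmono : MonotoneOn D (Ico b 1) := by
    refine monotoneOn_of_deriv_nonneg (convex_Ico _ _)
      (fun y hy => (hD y hy).continuousAt.continuousWithinAt)
      (fun y hy => (hD y (interior_subset hy)).differentiableAt.differentiableWithinAt)
      fun y hy => ?_
    have hy := interior_subset hy
    rw [(hD y hy).deriv]
    have h2 : f y < 3 * (1 - y) := hab ⟨by linarith [hy.1], hy.2⟩
    have h3 := hpos y ⟨by linarith [hy.1], hy.2⟩
    have h4 := one_div_le_one_div_of_le h3 h2.le
    have h5 : 1 / 3 * (-1 / (1 - y)) = -(1 / (3 * (1 - y))) := by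
      have : 1 - y ≠ 0 := (sub_pos.2 hy.2).ne'
      field_simp
    rw [h5]; linarith
  have hlog : Tendsto (fun y : ℝ => D b + 1 / 3 * -Real.log (1 - y)) (nhdsWithin 1 (Iio 1))
      atTop := by
    refine tendsto_atTop_add_const_left _ _ (Tendsto.const_mul_atTop (by norm_num) ?_)
    refine tendsto_neg_atBot_atTop.comp (Real.tendsto_log_nhdsGT_zero.comp ?_)
    refine tendsto_nhdsWithin_iff.2 ⟨?_, ?_⟩
    · have : Tendsto (fun y : ℝ => 1 - y) (nhds 1) (nhds (1 - 1)) := by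
        exact (continuous_const.sub continuous_id).tendsto 1
      rw [sub_self] at this
      exact this.mono_left nhdsWithin_le_nhds
    · filter_upwards [self_mem_nhdsWithin] with y hy using sub_pos.2 (mem_Iio.1 hy)
  refine tendsto_atTop_mono' _ ?_ hlog
  filter_upwards [Ioo_mem_nhdsLT hb1] with y hy
  have := hmono (left_mem_Ico.2 hb1) ⟨hy.1.le, hy.2⟩ hy.1.le
  simp only [D] at this ⊢
  linarith

/-- The two solutions of `f * (f * e')' = k ^ 2 * e`, extended by zero outside `(-1, 1)`:
`ep` is recessive at `-1` and `em` is recessive at `1`. -/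
structure IsExpPair (f : ℝ → ℝ) (k : ℕ) (ep em : ℝ → ℝ) : Prop where
  pos_left : ∀ x ∈ Ioo (-1 : ℝ) 1, 0 < ep x
  pos_right : ∀ x ∈ Ioo (-1 : ℝ) 1, 0 < em x
  mul_eq_one : ∀ x ∈ Ioo (-1 : ℝ) 1, ep x * em x = 1
  zero_left : ∀ x ∉ Ioo (-1 : ℝ) 1, ep x = 0
  zero_right : ∀ x ∉ Ioo (-1 : ℝ) 1, em x = 0
  hasDerivAt_left : ∀ x ∈ Ioo (-1 : ℝ) 1, HasDerivAt ep (k / f x * ep x) x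
  hasDerivAt_right : ∀ x ∈ Ioo (-1 : ℝ) 1, HasDerivAt em (-(k / f x) * em x) x
  contOn_left : ContinuousOn ep (Ico (-1) 1)
  contOn_right : ContinuousOn em (Ioc (-1) 1)

theorem IsProfile.exists_primitive_inv {f : ℝ → ℝ} (hf : IsProfile f) :
    ∃ s : ℝ → ℝ, ∀ x ∈ Ioo (-1 : ℝ) 1, HasDerivAt s (1 / f x) x := by
  have hc : ContinuousOn (fun x => 1 / f x) (Ioo (-1) 1) :=
    continuousOn_const.div hf.smoothOn.continuousOn fun x hx => (hf.pos x hx).ne'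
  refine ⟨fun x => ∫ y in (0 : ℝ)..x, 1 / f y, fun x hx => ?_⟩
  have hsub : uIcc 0 x ⊆ Ioo (-1 : ℝ) 1 :=
    OrdConnected.uIcc_subset ordConnected_Ioo (by norm_num) hx
  exact integral_hasDerivAt_right (hc.mono hsub).intervalIntegrable
    (hc.stronglyMeasurableAtFilter isOpen_Ioo x hx) (hc.continuousAt (isOpen_Ioo.mem_nhds hx))

theorem IsProfile.exists_isExpPair {f : ℝ → ℝ} (hf : IsProfile f) {k : ℕ} (hk : 1 ≤ k) :
    ∃ ep em, IsExpPair f k ep em := by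
  obtain ⟨s, hs⟩ := hf.exists_primitive_inv
  have hk0 : (0 : ℝ) < k := by exact_mod_cast hk
  have htop : Tendsto s (nhdsWithin 1 (Iio 1)) atTop :=
    tendsto_atTop_of_hasDerivAt_inv hf.pos hf.zero_one hf.deriv_one hs
  have hbot : Tendsto s (nhdsWithin (-1) (Ioi (-1))) atBot := by
    have href : Tendsto (fun x => -s (-x)) (nhdsWithin 1 (Iio 1)) atTop := by
      refine tendsto_atTop_of_hasDerivAt_inv (f := fun x => f (-x)) (fun x hx => ?_) ?_ ?_
        fun x hx => ?_
      · exact hf.pos (-x) ⟨by linarith [hx.2], by linarith [hx.1]⟩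
      · exact hf.zero_neg_one
      · have := HasDerivAt.comp (1 : ℝ) (h₂ := f) (h := fun x => -x) hf.deriv_neg_one
          (hasDerivAt_neg 1)
        simpa [Function.comp_def] using this
      · have := (HasDerivAt.comp x (h₂ := s) (h := fun x => -x)
          (hs (-x) ⟨by linarith [hx.2], by linarith [hx.1]⟩) (hasDerivAt_neg x)).neg
        convert! this using 1
        ring
    have hneg : Tendsto (fun x : ℝ => -x) (nhdsWithin (-1) (Ioi (-1))) (nhdsWithin 1 (Iio 1)) := by
      refine tendsto_nhdsWithin_iff.2 ⟨?_, ?_⟩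
      · have : Tendsto (fun x : ℝ => -x) (nhds (-1)) (nhds (-(-1))) := continuous_neg.tendsto _
        rw [neg_neg] at this
        exact this.mono_left nhdsWithin_le_nhds
      · filter_upwards [self_mem_nhdsWithin] with y hy
        have : (-1 : ℝ) < y := hy
        show -y < 1
        linarith
    have := tendsto_neg_atTop_atBot.comp (href.comp hneg)
    simpa [Function.comp_def] using this
  set J := Ioo (-1 : ℝ) 1 with hJ
  have indicator_eventuallyEq : ∀ g : ℝ → ℝ, ∀ x ∈ J, J.indicator g =ᶠ[nhds x] g := fun g x hx => by
    filter_upwards [isOpen_Ioo.mem_nhds hx] with y hy using indicator_of_mem hy g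
  have hdl : ∀ x ∈ J, HasDerivAt (J.indicator fun x => Real.exp (k * s x))
      (k / f x * J.indicator (fun x => Real.exp (k * s x)) x) x := by
    intro x hx
    refine HasDerivAt.congr_of_eventuallyEq ?_ (indicator_eventuallyEq _ x hx)
    rw [indicator_of_mem hx]
    convert! ((hs x hx).const_mul (k : ℝ)).exp using 1
    ring
  have hdr : ∀ x ∈ J, HasDerivAt (J.indicator fun x => Real.exp (-(k * s x)))
      (-(k / f x) * J.indicator (fun x => Real.exp (-(k * s x))) x) x := by
    intro x hx
    refine HasDerivAt.congr_of_eventuallyEq ?_ (indicator_eventuallyEq _ x hx)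
    rw [indicator_of_mem hx]
    convert! (((hs x hx).const_mul (k : ℝ)).neg).exp using 1
    simp only [Pi.neg_apply]
    ring
  refine ⟨J.indicator fun x => Real.exp (k * s x), J.indicator fun x => Real.exp (-(k * s x)),
    fun x hx => ?_, fun x hx => ?_, fun x hx => ?_, fun x hx => indicator_of_notMem hx _,
    fun x hx => indicator_of_notMem hx _, hdl, hdr, ?_, ?_⟩
  · rw [indicator_of_mem hx]; exact Real.exp_pos _
  · rw [indicator_of_mem hx]; exact Real.exp_pos _
  · rw [indicator_of_mem hx, indicator_of_mem hx, ← Real.exp_add, add_neg_cancel, Real.exp_zero]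
  · intro x hx
    rcases eq_or_lt_of_le hx.1 with rfl | h1
    · refine ContinuousWithinAt.mono (t := Ici (-1)) ?_ fun y hy => hy.1
      rw [← continuousWithinAt_Ioi_iff_Ici, ContinuousWithinAt, indicator_of_notMem (by simp [hJ])]
      have := Real.tendsto_exp_atBot.comp (hbot.const_mul_atBot hk0)
      refine this.congr' ?_
      filter_upwards [Ioo_mem_nhdsGT (by norm_num : (-1 : ℝ) < 1)] with y hy
      exact (indicator_of_mem hy _).symm
    · exact (hdl x ⟨h1, hx.2⟩).continuousAt.continuousWithinAt
  · intro x hx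
    rcases eq_or_lt_of_le hx.2 with rfl | h1
    · refine ContinuousWithinAt.mono (t := Iic 1) ?_ fun y hy => hy.2
      rw [← continuousWithinAt_Iio_iff_Iic, ContinuousWithinAt, indicator_of_notMem (by simp [hJ])]
      have := Real.tendsto_exp_neg_atTop_nhds_zero.comp (htop.const_mul_atTop hk0)
      refine this.congr' ?_
      filter_upwards [Ioo_mem_nhdsLT (by norm_num : (-1 : ℝ) < 1)] with y hy
      exact (indicator_of_mem hy _).symm
    · exact (hdr x ⟨hx.1, h1⟩).continuousAt.continuousWithinAt

namespace IsExpPair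

variable {f ep em : ℝ → ℝ} {k : ℕ}

theorem nonneg_left (h : IsExpPair f k ep em) (x : ℝ) : 0 ≤ ep x := by
  by_cases hx : x ∈ Ioo (-1 : ℝ) 1
  · exact (h.pos_left x hx).le
  · exact (h.zero_left x hx).ge

theorem nonneg_right (h : IsExpPair f k ep em) (x : ℝ) : 0 ≤ em x := by
  by_cases hx : x ∈ Ioo (-1 : ℝ) 1
  · exact (h.pos_right x hx).le
  · exact (h.zero_right x hx).ge

theorem monotoneOn_left (h : IsExpPair f k ep em) (hf : IsProfile f) :
    MonotoneOn ep (Ioo (-1) 1) := by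
  refine monotoneOn_of_deriv_nonneg (convex_Ioo _ _) (h.contOn_left.mono Ioo_subset_Ico_self)
    (fun x hx => (h.hasDerivAt_left x (interior_subset hx)).differentiableAt.differentiableWithinAt)
    fun x hx => ?_
  have hx := interior_subset hx
  rw [(h.hasDerivAt_left x hx).deriv]
  exact mul_nonneg (div_nonneg k.cast_nonneg (hf.pos x hx).le) (h.nonneg_left x)

theorem antitoneOn_right (h : IsExpPair f k ep em) (hf : IsProfile f) :
    AntitoneOn em (Ioo (-1) 1) := by
  intro x hx y hy hxy
  have h1 := h.monotoneOn_left hf hx hy hxy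
  have hx1 := h.mul_eq_one x hx
  have hy1 := h.mul_eq_one y hy
  have hxp := h.pos_left x hx
  rw [eq_one_div_of_mul_eq_one_right hx1, eq_one_div_of_mul_eq_one_right hy1]
  exact one_div_le_one_div_of_le hxp h1

/-- The Green kernel of `L_k`, up to the factor `1 / (2 * k)`. -/
noncomputable def _root_.greenKernel (ep em : ℝ → ℝ) (x z : ℝ) : ℝ :=
  min (em x * ep z) (ep x * em z)

theorem _root_.greenKernel_comm (ep em : ℝ → ℝ) (x z : ℝ) :
    greenKernel ep em x z = greenKernel ep em z x := by
  simp only [greenKernel, mul_comm (em x), mul_comm (ep x)]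
  exact min_comm _ _

theorem greenKernel_nonneg (h : IsExpPair f k ep em) (x z : ℝ) : 0 ≤ greenKernel ep em x z :=
  le_min (mul_nonneg (h.nonneg_right x) (h.nonneg_left z))
    (mul_nonneg (h.nonneg_left x) (h.nonneg_right z))

theorem greenKernel_pos (h : IsExpPair f k ep em) {x z : ℝ} (hx : x ∈ Ioo (-1 : ℝ) 1)
    (hz : z ∈ Ioo (-1 : ℝ) 1) : 0 < greenKernel ep em x z :=
  lt_min (mul_pos (h.pos_right x hx) (h.pos_left z hz))
    (mul_pos (h.pos_left x hx) (h.pos_right z hz))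

theorem greenKernel_eq_zero (h : IsExpPair f k ep em) {x : ℝ} (hx : x ∉ Ioo (-1 : ℝ) 1) (z : ℝ) :
    greenKernel ep em x z = 0 := by
  simp [greenKernel, h.zero_left x hx, h.zero_right x hx]

theorem greenKernel_le_one (h : IsExpPair f k ep em) (x z : ℝ) : greenKernel ep em x z ≤ 1 := by
  by_cases hx : x ∈ Ioo (-1 : ℝ) 1
  · by_cases hz : z ∈ Ioo (-1 : ℝ) 1
    · by_contra hcon
      obtain ⟨h1, h2⟩ := lt_min_iff.1 (not_le.1 hcon)
      have h3 : em x * ep z * (ep x * em z) = 1 := by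
        linear_combination (ep z * em z) * h.mul_eq_one x hx + h.mul_eq_one z hz
      nlinarith
    · rw [greenKernel_comm, h.greenKernel_eq_zero hz]; exact zero_le_one
  · rw [h.greenKernel_eq_zero hx]; exact zero_le_one

theorem greenKernel_of_le (h : IsExpPair f k ep em) (hf : IsProfile f) {x z : ℝ}
    (hzx : z ≤ x) : greenKernel ep em x z = em x * ep z := by
  refine min_eq_left ?_
  by_cases hx : x ∈ Ioo (-1 : ℝ) 1
  · by_cases hz : z ∈ Ioo (-1 : ℝ) 1
    · rw [mul_comm]
      exact mul_le_mul (h.monotoneOn_left hf hz hx hzx) (h.antitoneOn_right hf hz hx hzx)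
        (h.nonneg_right x) (h.nonneg_left x)
    · simp [h.zero_left z hz, h.zero_right z hz]
  · simp [h.zero_left x hx, h.zero_right x hx]

theorem continuousOn_greenKernel (h : IsExpPair f k ep em) (z : ℝ) :
    ContinuousOn (fun x => greenKernel ep em x z) (Icc (-1) 1) := by
  intro x hx
  rcases eq_or_lt_of_le hx.1 with rfl | h1
  · have h0 : ep (-1) = 0 := h.zero_left _ (by simp)
    have hc : ContinuousWithinAt ep (Icc (-1) 1) (-1) :=
      (h.contOn_left (-1) (by norm_num)).mono_of_mem_nhdsWithin (by
        filter_upwards [self_mem_nhdsWithin,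
          mem_nhdsWithin_of_mem_nhds (Iio_mem_nhds (by norm_num : (-1 : ℝ) < 1))] with y hy hy1
        exact ⟨hy.1, hy1⟩)
    have hlim := hc.tendsto.mul_const (em z)
    rw [h0, zero_mul] at hlim
    rw [ContinuousWithinAt, h.greenKernel_eq_zero (by simp)]
    exact squeeze_zero (fun y => h.greenKernel_nonneg y z) (fun y => min_le_right _ _) hlim
  rcases eq_or_lt_of_le hx.2 with rfl | h2
  · have h0 : em 1 = 0 := h.zero_right _ (by simp)
    have hc : ContinuousWithinAt em (Icc (-1) 1) 1 :=
      (h.contOn_right 1 (by norm_num)).mono_of_mem_nhdsWithin (by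
        filter_upwards [self_mem_nhdsWithin,
          mem_nhdsWithin_of_mem_nhds (Ioi_mem_nhds (by norm_num : (-1 : ℝ) < 1))] with y hy hy1
        exact ⟨hy1, hy.2⟩)
    have hlim := hc.tendsto.mul_const (ep z)
    rw [h0, zero_mul] at hlim
    rw [ContinuousWithinAt, h.greenKernel_eq_zero (by simp)]
    exact squeeze_zero (fun y => h.greenKernel_nonneg y z) (fun y => min_le_left _ _) hlim
  · have hc : ContinuousAt (fun y => greenKernel ep em y z) x :=
      Filter.Tendsto.min ((h.hasDerivAt_right x ⟨h1, h2⟩).continuousAt.tendsto.mul_const (ep z))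
        ((h.hasDerivAt_left x ⟨h1, h2⟩).continuousAt.tendsto.mul_const (em z))
    exact hc.continuousWithinAt

/-- The Green kernel has a positive continuous eigenfunction on `[-1, 1]`. -/
theorem exists_greenKernel_eigenfunction (h : IsExpPair f k ep em) (hf : IsProfile f) :
    ∃ lam : ℝ, 0 < lam ∧ ∃ w : ℝ → ℝ, Continuous w ∧ (∀ x, 0 ≤ w x) ∧
      (∃ x ∈ Icc (-1 : ℝ) 1, 0 < w x) ∧
      ∀ x ∈ Icc (-1 : ℝ) 1, w x = lam * ∫ z in (-1 : ℝ)..1, greenKernel ep em x z * w z := by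
  let X := Icc (-1 : ℝ) 1
  let μ : Measure X := Measure.comap Subtype.val volume
  have hμ : ∀ t : Set X, μ t = volume (Subtype.val '' t) :=
    comap_subtype_coe_apply measurableSet_Icc volume
  have : IsFiniteMeasure μ := ⟨by
    rw [hμ, image_univ, Subtype.range_coe]
    exact isCompact_Icc.measure_lt_top⟩
  have hcont : ∀ z : X, Continuous fun x : X => greenKernel ep em x z := fun z =>
    continuousOn_iff_continuous_domRestrict.1 (h.continuousOn_greenKernel z)
  have hG : IsBoundedKernel (fun x z : X => greenKernel ep em x z) 1 :=
    { nonneg := fun x z => h.greenKernel_nonneg x z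
      le := fun x z => h.greenKernel_le_one x z
      continuous_left := hcont
      measurable_right := fun x => by
        have := (hcont x).measurable
        simpa only [greenKernel_comm ep em _ (x : ℝ)] using this }
  have hIcc : ∀ x ∈ Icc (-1 / 2 : ℝ) (1 / 2), x ∈ Ioo (-1 : ℝ) 1 := fun x hx =>
    ⟨by linarith [hx.1], by linarith [hx.2]⟩
  have hlo : (-1 / 2 : ℝ) ∈ Ioo (-1 : ℝ) 1 := by norm_num
  have hhi : (1 / 2 : ℝ) ∈ Ioo (-1 : ℝ) 1 := by norm_num
  obtain ⟨lam, hlam, w, hw0, hwne, hw⟩ := hG.exists_eigenfunction (μ := μ)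
    (c := em (1 / 2) * ep (-1 / 2)) (mul_pos (h.pos_right _ hhi) (h.pos_left _ hlo))
    (M := Subtype.val ⁻¹' Icc (-1 / 2 : ℝ) (1 / 2))
    (measurable_subtype_coe measurableSet_Icc)
    (by
      rw [hμ, Subtype.image_preimage_coe, inter_eq_right.2 fun x hx =>
        Ioo_subset_Icc_self (hIcc x hx), Real.volume_Icc]
      norm_num)
    (fun x hx z hz => by
      have key : ∀ x ∈ Icc (-1 / 2 : ℝ) (1 / 2), ∀ z ∈ Icc (-1 / 2 : ℝ) (1 / 2),
          em (1 / 2) * ep (-1 / 2) ≤ em x * ep z := fun x hx z hz =>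
        mul_le_mul (h.antitoneOn_right hf (hIcc x hx) hhi hx.2)
          (h.monotoneOn_left hf hlo (hIcc z hz) hz.1) (h.nonneg_left _) (h.nonneg_right _)
      refine le_min (key x hx z hz) ?_
      rw [mul_comm (ep (x : ℝ))]
      exact key z hz x hx)
  have hle : (-1 : ℝ) ≤ 1 := by norm_num
  have hext : ∀ x : X, IccExtend hle w x = w x := fun x => IccExtend_val hle w x
  refine ⟨lam, hlam, IccExtend hle w, w.continuous.Icc_extend', fun x => hw0 _, ?_, ?_⟩
  · obtain ⟨x, hx⟩ : ∃ x, w x ≠ 0 := by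
      by_contra hcon
      push Not at hcon
      exact hwne (ContinuousMap.ext hcon)
    exact ⟨x, x.2, by rw [hext]; exact (hw0 x).lt_of_ne hx.symm⟩
  · intro x hx
    have h1 := hw ⟨x, hx⟩
    have h2 := integral_subtype_comap (μ := volume) (measurableSet_Icc (a := (-1 : ℝ)) (b := 1))
      fun z => greenKernel ep em x z * IccExtend hle w z
    rw [intervalIntegral.integral_of_le hle, ← integral_Icc_eq_integral_Ioc, ← h2,
      hext ⟨x, hx⟩, h1]
    simp only [hext]
    rfl

theorem exists_isGroundState (h : IsExpPair f k ep em) (hf : IsProfile f) (hk : 1 ≤ k) :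
    ∃ lam u V, IsGroundState f k lam u V := by
  obtain ⟨L, hL, w, hwc, hw0, ⟨x₀, hx₀, hwx₀⟩, hw⟩ := h.exists_greenKernel_eigenfunction hf
  have hzero : ∀ x ∈ Icc (-1 : ℝ) 1, x ∉ Ioo (-1 : ℝ) 1 → w x = 0 := by
    intro x hx hxo
    rw [hw x hx]
    simp [h.greenKernel_eq_zero hxo]
  have hx₀' : x₀ ∈ Ioo (-1 : ℝ) 1 := by
    by_contra hcon
    exact hwx₀.ne' (hzero x₀ hx₀ hcon)
  let P : ℝ → ℝ := fun x => ∫ z in (-1 : ℝ)..x, ep z * w z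
  let N : ℝ → ℝ := fun x => ∫ z in x..1, em z * w z
  have hiP : ∀ x ∈ Ioo (-1 : ℝ) 1, IntervalIntegrable (fun z => ep z * w z) volume (-1) x :=
    fun x hx => ContinuousOn.intervalIntegrable (by
      rw [uIcc_of_le hx.1.le]
      exact (h.contOn_left.mono (Icc_subset_Ico_right hx.2)).mul hwc.continuousOn)
  have hiN : ∀ x ∈ Ioo (-1 : ℝ) 1, IntervalIntegrable (fun z => em z * w z) volume x 1 :=
    fun x hx => ContinuousOn.intervalIntegrable (by
      rw [uIcc_of_le hx.2.le]
      exact (h.contOn_right.mono (Icc_subset_Ioc_left hx.1)).mul hwc.continuousOn)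
  have hcP : ContinuousOn (fun z => ep z * w z) (Ioo (-1) 1) :=
    (h.contOn_left.mono Ioo_subset_Ico_self).mul hwc.continuousOn
  have hcN : ContinuousOn (fun z => em z * w z) (Ioo (-1) 1) :=
    (h.contOn_right.mono Ioo_subset_Ioc_self).mul hwc.continuousOn
  have hdP : ∀ x ∈ Ioo (-1 : ℝ) 1, HasDerivAt P (ep x * w x) x := fun x hx =>
    integral_hasDerivAt_right (hiP x hx) (hcP.stronglyMeasurableAtFilter isOpen_Ioo x hx)
      (hcP.continuousAt (isOpen_Ioo.mem_nhds hx))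
  have hdN : ∀ x ∈ Ioo (-1 : ℝ) 1, HasDerivAt N (-(em x * w x)) x := fun x hx =>
    integral_hasDerivAt_left (hiN x hx) (hcN.stronglyMeasurableAtFilter isOpen_Ioo x hx)
      (hcN.continuousAt (isOpen_Ioo.mem_nhds hx))
  have hP0 : ∀ x ∈ Ioo (-1 : ℝ) 1, 0 ≤ P x := fun x hx =>
    intervalIntegral.integral_nonneg hx.1.le fun z _ => mul_nonneg (h.nonneg_left z) (hw0 z)
  have hN0 : ∀ x ∈ Ioo (-1 : ℝ) 1, 0 ≤ N x := fun x hx =>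
    intervalIntegral.integral_nonneg hx.2.le fun z _ => mul_nonneg (h.nonneg_right z) (hw0 z)
  have hrep : ∀ x ∈ Ioo (-1 : ℝ) 1, w x = L * (em x * P x + ep x * N x) := by
    intro x hx
    have hl : EqOn (fun z => greenKernel ep em x z * w z) (fun z => em x * (ep z * w z))
        (uIcc (-1) x) := fun z hz => by
      rw [uIcc_of_le hx.1.le] at hz
      simp only [h.greenKernel_of_le hf hz.2, mul_assoc]
    have hr : EqOn (fun z => greenKernel ep em x z * w z) (fun z => ep x * (em z * w z))
        (uIcc x 1) := fun z hz => by
      rw [uIcc_of_le hx.2.le] at hz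
      simp only [greenKernel_comm ep em x, h.greenKernel_of_le hf hz.1]
      ring
    rw [hw x (Ioo_subset_Icc_self hx), ← intervalIntegral.integral_add_adjacent_intervals
      (((hiP x hx).const_mul (em x)).congr (hl.symm.mono uIoc_subset_uIcc))
      (((hiN x hx).const_mul (ep x)).congr (hr.symm.mono uIoc_subset_uIcc)),
      intervalIntegral.integral_congr hl, intervalIntegral.integral_congr hr]
    simp only [intervalIntegral.integral_const_mul, P, N]
  let V : ℝ → ℝ := fun x => L * k * (ep x * N x - em x * P x)
  refine ⟨2 * k * L, w, V, hwc.continuousOn, ?_, fun _ => ?_, ?_, ?_, ?_⟩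
  · intro x hx
    rw [hw x (Ioo_subset_Icc_self hx)]
    refine mul_pos hL (intervalIntegral.integral_pos (by norm_num) ?_ ?_ ⟨x₀, hx₀, ?_⟩)
    · simp only [greenKernel_comm ep em x]
      exact (h.continuousOn_greenKernel x).mul hwc.continuousOn
    · exact fun z _ => mul_nonneg (h.greenKernel_nonneg x z) (hw0 z)
    · exact mul_pos (h.greenKernel_pos hx hx₀') hwx₀
  · exact ⟨hzero _ (by norm_num) (by simp), hzero _ (by norm_num) (by simp)⟩
  · intro x hx
    have h1 := ((((h.hasDerivAt_right x hx).mul (hdP x hx)).add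
      ((h.hasDerivAt_left x hx).mul (hdN x hx))).const_mul L)
    refine HasDerivAt.congr_of_eventuallyEq (f := fun x => L * (em x * P x + ep x * N x)) ?_ ?_
    · convert! h1 using 1
      simp only [V]
      ring
    · filter_upwards [isOpen_Ioo.mem_nhds hx] with y hy using hrep y hy
  · intro x hx
    have h1 := ((((h.hasDerivAt_left x hx).mul (hdN x hx)).sub
      ((h.hasDerivAt_right x hx).mul (hdP x hx))).const_mul (L * k))
    convert! h1 using 1
    have h2 := h.mul_eq_one x hx
    have h3 := hrep x hx
    linear_combination ((k : ℝ) ^ 2 / f x) * h3 + 2 * L * k * w x * h2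
  · intro x hx
    have hA := mul_nonneg (h.nonneg_right x) (hP0 x hx)
    have hB := mul_nonneg (h.nonneg_left x) (hN0 x hx)
    rw [hrep x hx]
    simp only [V]
    rw [abs_mul, abs_of_nonneg (by positivity), mul_comm L, mul_assoc]
    refine mul_le_mul_of_nonneg_left (mul_le_mul_of_nonneg_left ?_ hL.le) k.cast_nonneg
    rw [abs_le]
    constructor <;> linarith

end IsExpPair

theorem IsProfile.exists_isGroundState {f : ℝ → ℝ} (hf : IsProfile f) (k : ℕ) :
    ∃ lam u V, IsGroundState f k lam u V := by
  rcases Nat.eq_zero_or_pos k with rfl | hk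
  · exact ⟨_, _, _, isGroundState_zero f⟩
  · obtain ⟨ep, em, h⟩ := hf.exists_isExpPair hk
    exact h.exists_isGroundState hf hk

/-- If `m + 1` distinct values of a monotone sequence are at most `B`, then so is its value
at `m`. -/
theorem le_of_injective_of_monotone {Λ : ℕ → ℝ} (hΛ : Monotone Λ) {m : ℕ} {B : ℝ}
    {g : Fin (m + 1) → ℝ} (hg : Function.Injective g) (hmem : ∀ i, g i ∈ range Λ)
    (hB : ∀ i, g i ≤ B) : Λ m ≤ B := by
  choose n hn using hmem
  have hinj : Function.Injective n := fun i j hij => hg (by rw [← hn i, ← hn j, hij])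
  obtain ⟨i, hi⟩ : ∃ i, m ≤ n i := by
    by_contra! hcon
    have := Fintype.card_le_of_injective (fun i => (⟨n i, hcon i⟩ : Fin m))
      fun i j hij => hinj (Fin.mk.inj hij)
    simp at this
  exact (hΛ hi).trans ((hn i).le.trans (hB i))

/-- Upper bound for the `m`-th distinct eigenvalue obtained from the test function
`f^{l/2}` in the Rayleigh quotient, where `K = -f''/2` is the Gauss curvature. -/
theorem eigenvalue_upper_bound_general (f : ℝ → ℝ) (hf : IsProfile f)
    (hf' : ContinuousOn (deriv f) (Icc (-1) 1))
    (Λ : ℕ → ℝ) (hΛmono : StrictMono Λ) (hΛrange : Set.range Λ = Eigs f)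
    (m l : ℕ) (hm : 1 ≤ m) (hl : 1 ≤ l)
    (hint : IntervalIntegrable (fun x => f x ^ l * deriv (deriv f) x) volume (-1) 1) :
    Λ m ≤ (m:ℝ)^2 * ((∫ x in (-1:ℝ)..1, f x ^ (l - 1)) / (∫ x in (-1:ℝ)..1, f x ^ l))
      + ((l:ℝ) * ∫ x in (-1:ℝ)..1, f x ^ l * (-(deriv (deriv f) x) / 2))
          / (2 * ∫ x in (-1:ℝ)..1, f x ^ l) := by
  choose lam u V hground using hf.exists_isGroundState
  have hpos : 0 < ∫ x in (-1 : ℝ)..1, f x ^ l := by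
    refine intervalIntegral.integral_pos (by norm_num) (hf.contOn.pow l) (fun x hx => ?_)
      ⟨0, by norm_num, pow_pos (hf.pos 0 (by norm_num)) l⟩
    rcases eq_or_lt_of_le hx.2 with rfl | h1
    · simp [hf.zero_one]
    · exact (pow_pos (hf.pos x ⟨hx.1, h1⟩) l).le
  have hnonneg : 0 ≤ ∫ x in (-1 : ℝ)..1, f x ^ (l - 1) := by
    refine intervalIntegral.integral_nonneg (by norm_num) fun x hx => pow_nonneg ?_ _
    rcases eq_or_lt_of_le hx.1 with rfl | h1
    · exact hf.zero_neg_one.ge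
    rcases eq_or_lt_of_le hx.2 with rfl | h2
    · exact hf.zero_one.ge
    · exact (hf.pos x ⟨h1, h2⟩).le
  refine le_of_injective_of_monotone hΛmono.monotone (g := fun i : Fin (m + 1) => lam i)
    (fun i j hij => ?_) (fun i => ?_) (fun i => ?_)
  · rcases lt_trichotomy (i : ℕ) j with h | h | h
    · exact absurd hij ((hground i).ne_of_lt hf (hground j) h)
    · exact Fin.ext h
    · exact absurd hij.symm ((hground j).ne_of_lt hf (hground i) h)
  · rw [hΛrange]
    exact mem_iUnion.2 ⟨i, (hground i).inSpec hf⟩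
  · have hle := (hground i).mul_integral_pow_le hf hf' hl hint
    have him : (i : ℝ) ^ 2 ≤ (m : ℝ) ^ 2 := by
      gcongr
      exact_mod_cast Nat.lt_succ_iff.1 i.2
    have hK : ∫ x in (-1 : ℝ)..1, f x ^ l * (-(deriv (deriv f) x) / 2)
        = -(1 / 2) * ∫ x in (-1 : ℝ)..1, f x ^ l * deriv (deriv f) x := by
      rw [← intervalIntegral.integral_const_mul]
      congr 1
      ext x
      ring
    rw [hK, ← sub_nonneg]
    have hmul := mul_le_mul_of_nonneg_right him hnonneg
    set I := ∫ x in (-1 : ℝ)..1, f x ^ l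
    set I' := ∫ x in (-1 : ℝ)..1, f x ^ (l - 1)
    set R := ∫ x in (-1 : ℝ)..1, f x ^ l * deriv (deriv f) x
    have : (m : ℝ) ^ 2 * (I' / I) + (l * (-(1 / 2) * R)) / (2 * I) - lam i
        = ((m : ℝ) ^ 2 * I' - l / 4 * R - lam i * I) / I := by
      field_simp
      ring
    rw [this]
    exact div_nonneg (by linarith) hpos.le
end

section
/- Let f be a profile function whose derivative f' extends continuously to [-1,1], and let Λ : ℕ → ℝ be the strictly increasing enumeration of E(f) = ⋃_{k ≥ 0} Spec L_k. Then for every integer m ≥ 1 such that x ↦ f(x)^m · f''(x) is interval integrable on [-1,1], with K(x) = -f''(x)/2, the m-th distinct Laplace eigenvalue satisfies Λ(m) ≤ m² · (∫_{-1}^{1} f(x)^{m-1} dx)/(∫_{-1}^{1} f(x)^{m} dx) + (m · ∫_{-1}^{1} f(x)^{m} K(x) dx)/(2 · ∫_{-1}^{1} f(x)^{m} dx). -/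
open Set MeasureTheory intervalIntegral Filter

/-- A compact symmetric operator attains the supremum of its Rayleigh quotient as an eigenvalue,
as soon as the quadratic form takes a positive value. -/
theorem exists_top_eigenvector {H : Type*} [NormedAddCommGroup H] [InnerProductSpace ℝ H]
    (A : H →L[ℝ] H) (hc : IsCompactOperator A) (hs : ∀ v w, inner ℝ (A v) w = inner ℝ v (A w))
    {v₀ : H} (h₀ : 0 < inner ℝ (A v₀) v₀) :
    ∃ M : ℝ, 0 < M ∧ (∃ v, v ≠ 0 ∧ A v = M • v) ∧ ∀ w, inner ℝ (A w) w ≤ M * ‖w‖ ^ 2 := by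
  set S : Set ℝ := (fun v : H => inner ℝ (A v) v) '' {v | ‖v‖ = 1} with hS
  have hbdd : BddAbove S := by
    refine ⟨‖A‖, ?_⟩
    rintro _ ⟨v, hv, rfl⟩
    have hv : ‖v‖ = 1 := hv
    calc inner ℝ (A v) v ≤ ‖A v‖ * ‖v‖ := real_inner_le_norm _ _
      _ ≤ ‖A‖ := by simpa [hv] using A.le_opNorm v
  have hle : ∀ w, inner ℝ (A w) w ≤ sSup S * ‖w‖ ^ 2 := by
    intro w
    rcases eq_or_ne w 0 with rfl | hw
    · simp
    have hw' : 0 < ‖w‖ := norm_pos_iff.2 hw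
    have := le_csSup hbdd ⟨‖w‖⁻¹ • w, by simp [norm_smul, hw'.ne'], rfl⟩
    simp only [map_smul, inner_smul_left, inner_smul_right, conj_trivial] at this
    calc inner ℝ (A w) w = (‖w‖⁻¹ * (‖w‖⁻¹ * inner ℝ (A w) w)) * ‖w‖ ^ 2 := by field_simp
      _ ≤ _ := by gcongr
  have hv₀ : v₀ ≠ 0 := by rintro rfl; simp at h₀
  have hM : 0 < sSup S := by
    have := h₀.trans_le (hle v₀)
    exact pos_of_mul_pos_left this (by positivity)
  have hne : S.Nonempty := ⟨_, ‖v₀‖⁻¹ • v₀, by simp [norm_smul, norm_ne_zero_iff.2 hv₀], rfl⟩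
  refine ⟨sSup S, hM, ?_, hle⟩
  set M := sSup S
  set B : H →L[ℝ] H := A - M • 1 with hB
  have hBs : ∀ v w, inner ℝ (B v) w = inner ℝ v (B w) := by
    intro v w
    simp [hB, inner_sub_left, inner_sub_right, hs, inner_smul_left, inner_smul_right]
  have hBneg : ∀ w, inner ℝ (B w) w ≤ 0 := by
    intro w
    have := hle w
    simp only [hB, sub_apply, smul_apply,
      one_apply_eq_self, inner_sub_left, inner_smul_left, conj_trivial,
      real_inner_self_eq_norm_sq]
    linarith
  have hBsq : ∀ v, ‖B v‖ ^ 2 ≤ (‖B‖ + 1) * (-inner ℝ (B v) v) := by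
    intro v
    have hb : 0 < ‖B‖ + 1 := by positivity
    have h1 := hBneg (v + (‖B‖ + 1)⁻¹ • B v)
    have h2 : -inner ℝ (B (B v)) (B v) ≤ ‖B‖ * ‖B v‖ ^ 2 := by
      have := (abs_le.1 (abs_real_inner_le_norm (B (B v)) (B v))).1
      have := mul_le_mul_of_nonneg_right (B.le_opNorm (B v)) (norm_nonneg (B v))
      nlinarith
    simp only [map_add, map_smul, inner_add_left, inner_add_right, inner_smul_left,
      inner_smul_right, conj_trivial, real_inner_self_eq_norm_sq, hBs (B v) v] at h1
    set b := ‖B‖ + 1 with hbdef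
    have hb1 : ‖B‖ = b - 1 := by rw [hbdef]; ring
    rw [hb1] at h2
    have h3 : b ^ 2 * (inner ℝ (B v) v + b⁻¹ * ‖B v‖ ^ 2 +
        (b⁻¹ * ‖B v‖ ^ 2 + b⁻¹ * (b⁻¹ * inner ℝ (B (B v)) (B v)))) ≤ 0 := by
      refine mul_nonpos_of_nonneg_of_nonpos (by positivity) ?_
      linarith
    have h4 : b ^ 2 * (inner ℝ (B v) v + b⁻¹ * ‖B v‖ ^ 2 +
        (b⁻¹ * ‖B v‖ ^ 2 + b⁻¹ * (b⁻¹ * inner ℝ (B (B v)) (B v)))) =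
        b ^ 2 * inner ℝ (B v) v + 2 * b * ‖B v‖ ^ 2 + inner ℝ (B (B v)) (B v) := by
      field_simp; ring
    have h5 : b * ‖B v‖ ^ 2 ≤ b * (b * (-inner ℝ (B v) v)) := by
      nlinarith [sq_nonneg ‖B v‖]
    exact le_of_mul_le_mul_left h5 hb
  by_contra hno
  have hnot : ¬ Module.End.HasEigenvalue (A : Module.End ℝ H) M := by
    intro h
    obtain ⟨v, hv⟩ := h.exists_hasEigenvector
    exact hno ⟨v, hv.2, hv.apply_eq_smul⟩
  obtain ⟨K, hK⟩ := hc.antilipschitz_of_not_hasEigenvalue hM.ne' hnot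
  obtain ⟨_, ⟨v, hv, rfl⟩, hlt⟩ := exists_lt_of_lt_csSup hne
    (show M - (((K : ℝ) ^ 2 + 1) * (‖B‖ + 1))⁻¹ < sSup S from sub_lt_self _ (by positivity))
  have hv : ‖v‖ = 1 := hv
  have h1 : 1 ≤ (K : ℝ) * ‖B v‖ := by
    have := hK.le_mul_dist v 0
    simpa [hv, hB] using this
  have h2 : -inner ℝ (B v) v < (((K : ℝ) ^ 2 + 1) * (‖B‖ + 1))⁻¹ := by
    simp only [hB, sub_apply, smul_apply,
      one_apply_eq_self, inner_sub_left, inner_smul_left, conj_trivial,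
      real_inner_self_eq_norm_sq, hv]
    simp only [hB] at hlt
    linarith
  have h3 := hBsq v
  have hb : 0 < ‖B‖ + 1 := by positivity
  have h4 : ‖B v‖ ^ 2 < ((K : ℝ) ^ 2 + 1)⁻¹ := by
    refine h3.trans_lt ((mul_lt_mul_of_pos_left h2 hb).trans_le (le_of_eq ?_))
    field_simp
  have h5 : ((K : ℝ) ^ 2 + 1) * ‖B v‖ ^ 2 < 1 := by
    have := mul_lt_mul_of_pos_left h4 (show 0 < (K : ℝ) ^ 2 + 1 by positivity)
    rwa [mul_inv_cancel₀ (by positivity)] at this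
  nlinarith [sq_nonneg ‖B v‖]

/-- Pairing with a continuous family of vectors in an inner product space, indexed by a compact
space, as an operator into bounded continuous functions. -/
noncomputable def pairingCLM {K H : Type*} [TopologicalSpace K] [CompactSpace K]
    [NormedAddCommGroup H] [InnerProductSpace ℝ H] (g : C(K, H)) :
    H →L[ℝ] BoundedContinuousFunction K ℝ :=
  LinearMap.mkContinuous
    { toFun := fun v => BoundedContinuousFunction.mkOfCompact
        ⟨fun x => inner ℝ (g x) v, by fun_prop⟩
      map_add' := fun v w => by ext x; simp [inner_add_right]
      map_smul' := fun c v => by ext x; simp [inner_smul_right] }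
    ‖g‖ fun v => by
      refine (BoundedContinuousFunction.norm_le (by positivity)).2 fun x => ?_
      exact (norm_inner_le_norm _ _).trans (by gcongr; exact g.norm_coe_le_norm x)

theorem pairingCLM_apply {K H : Type*} [TopologicalSpace K] [CompactSpace K]
    [NormedAddCommGroup H] [InnerProductSpace ℝ H] (g : C(K, H)) (v : H) (x : K) :
    pairingCLM g v x = inner ℝ (g x) v := rfl

theorem isCompactOperator_pairingCLM {K H : Type*} [TopologicalSpace K] [CompactSpace K]
    [NormedAddCommGroup H] [InnerProductSpace ℝ H] (g : C(K, H)) :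
    IsCompactOperator (pairingCLM g) := by
  rw [← ContinuousLinearMap.coe_coe,
    isCompactOperator_iff_isCompact_closure_image_closedBall _ one_pos]
  refine BoundedContinuousFunction.arzela_ascoli (Metric.closedBall 0 ‖g‖)
    (isCompact_closedBall _ _) _ ?_ ?_
  · rintro _ x ⟨v, hv, rfl⟩
    rw [mem_closedBall_zero_iff] at hv ⊢
    refine (norm_inner_le_norm (g x) v).trans ?_
    calc ‖g x‖ * ‖v‖ ≤ ‖g‖ * 1 := by gcongr; exact g.norm_coe_le_norm x
      _ = ‖g‖ := mul_one _
  · intro x₀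
    refine Metric.equicontinuousAt_of_continuity_modulus (fun x => ‖g x₀ - g x‖) ?_ _ ?_
    · have : Continuous fun x => ‖g x₀ - g x‖ := by fun_prop
      simpa using this.tendsto x₀
    · refine Eventually.of_forall fun x => ?_
      rintro ⟨_, v, hv, rfl⟩
      rw [mem_closedBall_zero_iff] at hv
      change dist (inner ℝ (g x₀) v) (inner ℝ (g x) v) ≤ _
      rw [Real.dist_eq, ← inner_sub_left]
      refine (abs_real_inner_le_norm _ _).trans ?_
      exact mul_le_of_le_one_right (norm_nonneg _) hv

theorem exists_kernel_top_eigenfunction {K : Type*} [TopologicalSpace K] [CompactSpace K]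
    [SecondCountableTopology K] [MeasurableSpace K] [BorelSpace K]
    (μ : Measure K) [IsFiniteMeasure μ] (G : K → K → ℝ) (hm : Measurable (Function.uncurry G))
    (hsymm : ∀ x y, G x y = G y x) (C : ℝ) (hb : ∀ x y, |G x y| ≤ C)
    (hcont : ∀ x₀, ∀ᵐ y ∂μ, Tendsto (fun x => G x y) (nhds x₀) (nhds (G x₀ y)))
    (hpos : 0 < ∫ x, ∫ y, G x y ∂μ ∂μ) :
    ∃ M : ℝ, 0 < M ∧
      (∃ u : C(K, ℝ), (∃ x, u x ≠ 0) ∧ ∀ x, ∫ y, G x y * u y ∂μ = M * u x) ∧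
      ∀ φ : C(K, ℝ), ∫ x, (∫ y, G x y * φ y ∂μ) * φ x ∂μ ≤ M * ∫ x, φ x ^ 2 ∂μ := by
  have hmx : ∀ x, Measurable (G x) := fun x => hm.comp measurable_prodMk_left
  have hLp : ∀ x, MemLp (G x) 2 μ := fun x =>
    MemLp.of_bound (hmx x).aestronglyMeasurable C (Eventually.of_forall fun y => hb x y)
  have hg : Continuous fun x => (hLp x).toLp := by
    refine continuous_iff_continuousAt.2 fun x₀ => ?_
    refine tendsto_iff_norm_sub_tendsto_zero.2 ?_
    have hsq : ∀ x, ‖(hLp x).toLp - (hLp x₀).toLp‖ ^ 2 = ∫ y, (G x y - G x₀ y) ^ 2 ∂μ := by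
      intro x
      rw [← real_inner_self_eq_norm_sq, L2.inner_def, ← MemLp.toLp_sub]
      refine integral_congr_ae ?_
      filter_upwards [((hLp x).sub (hLp x₀)).coeFn_toLp] with y hy
      rw [hy]
      simp [sq]
    have hlim : Tendsto (fun x => ∫ y, (G x y - G x₀ y) ^ 2 ∂μ) (nhds x₀) (nhds 0) := by
      have : (0 : ℝ) = ∫ y, (0 : ℝ) ∂μ := by simp
      rw [this]
      refine tendsto_integral_filter_of_dominated_convergence (fun _ => (2 * C) ^ 2) ?_ ?_
        (integrable_const _) ?_
      · exact Eventually.of_forall fun x =>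
          (((hmx x).sub (hmx x₀)).pow_const 2).aestronglyMeasurable
      · refine Eventually.of_forall fun x => Eventually.of_forall fun y => ?_
        rw [Real.norm_eq_abs, abs_pow]
        gcongr
        have := abs_sub (G x y) (G x₀ y)
        linarith [hb x y, hb x₀ y]
      · filter_upwards [hcont x₀] with y hy
        have := ((hy.sub_const (G x₀ y)).pow 2)
        simpa using this
    have := hlim.sqrt
    simp only [← hsq, Real.sqrt_zero] at this
    simpa using this
  set g : C(K, Lp ℝ 2 μ) := ⟨_, hg⟩
  set ι := BoundedContinuousFunction.toLp (E := ℝ) 2 μ ℝ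
  set A : Lp ℝ 2 μ →L[ℝ] Lp ℝ 2 μ := ι.comp (pairingCLM g) with hA
  have hcomp : IsCompactOperator A := (isCompactOperator_pairingCLM g).clm_comp ι
  have hT : ∀ (v : Lp ℝ 2 μ) x, pairingCLM g v x = ∫ y, G x y * v y ∂μ := by
    intro v x
    rw [pairingCLM_apply, L2.inner_def]
    refine integral_congr_ae ?_
    filter_upwards [(hLp x).coeFn_toLp] with y hy
    change inner ℝ (((hLp x).toLp : Lp ℝ 2 μ) y) (v y) = _
    rw [hy]
    simp [mul_comm]
  have hinner : ∀ v w : Lp ℝ 2 μ, inner ℝ (A v) w = ∫ x, ∫ y, G x y * (w x * v y) ∂μ ∂μ := by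
    intro v w
    rw [L2.inner_def]
    refine integral_congr_ae ?_
    filter_upwards [BoundedContinuousFunction.coeFn_toLp 2 μ ℝ (pairingCLM g v)] with x hx
    change inner ℝ (ι (pairingCLM g v) x) (w x) = _
    rw [hx, hT]
    simp only [RCLike.inner_apply, conj_trivial]
    rw [← MeasureTheory.integral_const_mul]
    exact integral_congr_ae (Eventually.of_forall fun y => by ring)
  have hs : ∀ v w, inner ℝ (A v) w = inner ℝ v (A w) := by
    intro v w
    have hv : Integrable v μ := (Lp.memLp v).integrable (by norm_num)
    have hw : Integrable w μ := (Lp.memLp w).integrable (by norm_num)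
    rw [real_inner_comm _ v, hinner, hinner, integral_integral_swap]
    · refine integral_congr_ae (Eventually.of_forall fun x => ?_)
      refine integral_congr_ae (Eventually.of_forall fun y => ?_)
      simp only [hsymm x y]
      ring
    · refine (hw.mul_prod hv).bdd_mul (c := C) hm.aestronglyMeasurable ?_
      exact Eventually.of_forall fun z => hb z.1 z.2
  have hιφ : ∀ (φ : C(K, ℝ)) x, pairingCLM g (ι (.mkOfCompact φ)) x = ∫ y, G x y * φ y ∂μ := by
    intro φ x
    rw [hT]
    refine integral_congr_ae ?_
    filter_upwards [BoundedContinuousFunction.coeFn_toLp 2 μ ℝ (.mkOfCompact φ)] with y hy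
    rw [hy]; rfl
  have hform : ∀ φ : C(K, ℝ), inner ℝ (A (ι (.mkOfCompact φ))) (ι (.mkOfCompact φ)) =
      ∫ x, (∫ y, G x y * φ y ∂μ) * φ x ∂μ := by
    intro φ
    rw [hA, ContinuousLinearMap.comp_apply, BoundedContinuousFunction.inner_toLp]
    refine integral_congr_ae (Eventually.of_forall fun x => ?_)
    simp only [hιφ, conj_trivial]
    exact mul_comm _ _
  obtain ⟨M, hM, ⟨v, hv, hAv⟩, hle⟩ := exists_top_eigenvector A hcomp hs
    (v₀ := ι (.mkOfCompact 1)) (by rw [hform]; simpa using hpos)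
  refine ⟨M, hM, ?_, ?_⟩
  · set u : BoundedContinuousFunction K ℝ := M⁻¹ • pairingCLM g v with hu
    have hιu : ι u = v := by
      rw [hu, map_smul]
      change M⁻¹ • A v = v
      rw [hAv, smul_smul, inv_mul_cancel₀ hM.ne', one_smul]
    refine ⟨u.toContinuousMap, ?_, fun x => ?_⟩
    · by_contra! h
      apply hv
      have : u = 0 := by ext x; exact h x
      rw [← hιu, this, map_zero]
    · rw [← hιφ]
      change pairingCLM g (ι u) x = M * (M⁻¹ * pairingCLM g v x)
      rw [hιu, mul_inv_cancel_left₀ hM.ne']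
  · intro φ
    rw [← hform]
    refine (hle _).trans_eq ?_
    rw [← real_inner_self_eq_norm_sq, BoundedContinuousFunction.inner_toLp]
    congr 1
    refine integral_congr_ae (Eventually.of_forall fun x => ?_)
    simp [sq]

theorem IsProfile.hasDerivAt {f : ℝ → ℝ} (hf : IsProfile f) {x : ℝ} (hx : x ∈ Ioo (-1:ℝ) 1) :
    HasDerivAt f (deriv f x) x :=
  ((hf.smoothOn.contDiffAt (isOpen_Ioo.mem_nhds hx)).differentiableAt (by simp)).hasDerivAt

theorem IsProfile.hasDerivAt_deriv {f : ℝ → ℝ} (hf : IsProfile f) {x : ℝ}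
    (hx : x ∈ Ioo (-1:ℝ) 1) : HasDerivAt (deriv f) (deriv (deriv f) x) x := by
  have h : ContDiffOn ℝ 1 (deriv f) (Ioo (-1) 1) :=
    hf.smoothOn.deriv_of_isOpen isOpen_Ioo (by norm_cast)
  exact ((h.contDiffAt (isOpen_Ioo.mem_nhds hx)).differentiableAt (by simp)).hasDerivAt

theorem IsProfile.exists_linear_bounds {f : ℝ → ℝ} (hf : IsProfile f)
    (hf' : ContinuousOn (deriv f) (Icc (-1) 1)) :
    ∃ C > 0, ∀ x ∈ Icc (-1:ℝ) 1, f x ≤ C * (1 - x) ∧ f x ≤ C * (1 + x) := by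
  obtain ⟨C, hC⟩ := isCompact_Icc.exists_bound_of_continuousOn hf'
  have hd : ∀ x ∈ Icc (-1:ℝ) 1, HasDerivWithinAt f (deriv f x) (Icc (-1) 1) x := by
    intro x hx
    rcases eq_or_lt_of_le hx.1 with rfl | h1
    · exact hf.deriv_neg_one.differentiableAt.hasDerivAt.hasDerivWithinAt
    rcases eq_or_lt_of_le hx.2 with rfl | h2
    · exact hf.deriv_one.differentiableAt.hasDerivAt.hasDerivWithinAt
    exact (hf.hasDerivAt ⟨h1, h2⟩).hasDerivWithinAt
  have hlip : ∀ x ∈ Icc (-1:ℝ) 1, ∀ y ∈ Icc (-1:ℝ) 1, ‖f y - f x‖ ≤ C * ‖y - x‖ :=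
    fun x hx y hy => (convex_Icc _ _).norm_image_sub_le_of_norm_hasDerivWithin_le hd hC hx hy
  refine ⟨|C| + 1, by positivity, fun x hx => ⟨?_, ?_⟩⟩
  · have h := hlip 1 (by simp) x hx
    rw [hf.zero_one, sub_zero, Real.norm_eq_abs, Real.norm_eq_abs,
      abs_of_nonpos (by linarith [hx.2] : x - 1 ≤ 0)] at h
    nlinarith [le_abs_self (f x), le_abs_self C, hx.2]
  · have h := hlip (-1) (by simp) x hx
    rw [hf.zero_neg_one, sub_zero, Real.norm_eq_abs, Real.norm_eq_abs,
      abs_of_nonneg (by linarith [hx.1] : 0 ≤ x - -1)] at h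
    nlinarith [le_abs_self (f x), le_abs_self C, hx.1]

/-- A cylindrical coordinate for the profile `f`: a primitive of `1 / f` on `(-1, 1)` that is
unbounded at both poles. -/
structure IsCylCoord (f τ : ℝ → ℝ) : Prop where
  measurable : Measurable τ
  hasDerivAt : ∀ x ∈ Ioo (-1:ℝ) 1, HasDerivAt τ (1 / f x) x
  tendsto_one : Tendsto (fun x => |τ x|) (nhdsWithin 1 (Ioo (-1) 1)) atTop
  tendsto_neg_one : Tendsto (fun x => |τ x|) (nhdsWithin (-1) (Ioo (-1) 1)) atTop

theorem IsProfile.exists_isCylCoord {f : ℝ → ℝ} (hf : IsProfile f)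
    (hf' : ContinuousOn (deriv f) (Icc (-1) 1)) : ∃ τ, IsCylCoord f τ := by
  classical
  obtain ⟨C, hC, hbd⟩ := hf.exists_linear_bounds hf'
  set σ : ℝ → ℝ := fun x => ∫ y in (0:ℝ)..x, 1 / f y with hσ
  have hinv : ContinuousOn (fun y => 1 / f y) (Ioo (-1) 1) :=
    continuousOn_const.div (hf.contOn.mono Ioo_subset_Icc_self) fun x hx => (hf.pos x hx).ne'
  have h0 : (0:ℝ) ∈ Ioo (-1:ℝ) 1 := by norm_num
  have hder : ∀ x ∈ Ioo (-1:ℝ) 1, HasDerivAt σ (1 / f x) x := by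
    intro x hx
    refine integral_hasDerivAt_right ?_ (hinv.stronglyMeasurableAtFilter isOpen_Ioo x hx)
      (hinv.continuousAt (isOpen_Ioo.mem_nhds hx))
    exact (hinv.mono (ordConnected_Ioo.uIcc_subset h0 hx)).intervalIntegrable
  have hσ0 : σ 0 = 0 := by simp [hσ]
  have hright : ∀ x ∈ Ico (0:ℝ) 1, -(Real.log (1 - x) / C) ≤ σ x := by
    intro x hx
    have hmono : MonotoneOn (fun y => σ y + Real.log (1 - y) / C) (Ico 0 1) := by
      have hd : ∀ y ∈ Ico (0:ℝ) 1, HasDerivAt (fun y => σ y + Real.log (1 - y) / C)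
          (1 / f y + (-1) / (1 - y) / C) y := by
        intro y hy
        have hy1 : 1 - y ≠ 0 := by linarith [hy.2]
        exact (hder y ⟨by linarith [hy.1], hy.2⟩).add
          ((((hasDerivAt_id y).const_sub 1).log hy1).div_const C)
      refine monotoneOn_of_deriv_nonneg (convex_Ico _ _)
        (fun y hy => (hd y hy).continuousAt.continuousWithinAt)
        (fun y hy => (hd y (interior_subset hy)).differentiableAt.differentiableWithinAt) ?_
      intro y hy
      have hy' := interior_subset hy
      have hyI : y ∈ Ioo (-1:ℝ) 1 := ⟨by linarith [hy'.1], hy'.2⟩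
      rw [(hd y hy').deriv]
      have h1 : 0 < 1 - y := by linarith [hy'.2]
      have h2 := one_div_le_one_div_of_le (hf.pos y hyI) (hbd y ⟨hyI.1.le, hyI.2.le⟩).1
      have h3 : (-1) / (1 - y) / C = -(1 / (C * (1 - y))) := by field_simp
      rw [h3]; linarith
    have := hmono (by simp : (0:ℝ) ∈ Ico (0:ℝ) 1) hx hx.1
    simp only [hσ0, sub_zero, Real.log_one, zero_div, add_zero] at this
    linarith
  have hleft : ∀ x ∈ Ioc (-1:ℝ) 0, σ x ≤ Real.log (1 + x) / C := by
    intro x hx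
    have hmono : MonotoneOn (fun y => σ y - Real.log (1 + y) / C) (Ioc (-1) 0) := by
      have hd : ∀ y ∈ Ioc (-1:ℝ) 0, HasDerivAt (fun y => σ y - Real.log (1 + y) / C)
          (1 / f y - 1 / (1 + y) / C) y := by
        intro y hy
        have hy1 : 1 + y ≠ 0 := by linarith [hy.1]
        exact (hder y ⟨hy.1, by linarith [hy.2]⟩).sub
          ((((hasDerivAt_id y).const_add 1).log hy1).div_const C)
      refine monotoneOn_of_deriv_nonneg (convex_Ioc _ _)
        (fun y hy => (hd y hy).continuousAt.continuousWithinAt)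
        (fun y hy => (hd y (interior_subset hy)).differentiableAt.differentiableWithinAt) ?_
      intro y hy
      have hy' := interior_subset hy
      have hyI : y ∈ Ioo (-1:ℝ) 1 := ⟨hy'.1, by linarith [hy'.2]⟩
      rw [(hd y hy').deriv]
      have h1 : 0 < 1 + y := by linarith [hy'.1]
      have h2 := one_div_le_one_div_of_le (hf.pos y hyI) (hbd y ⟨hyI.1.le, hyI.2.le⟩).2
      have h3 : 1 / (1 + y) / C = 1 / (C * (1 + y)) := by field_simp
      rw [h3]; linarith
    have := hmono hx (by simp : (0:ℝ) ∈ Ioc (-1:ℝ) 0) hx.2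
    simp only [hσ0, add_zero, Real.log_one, zero_div, sub_zero] at this
    linarith
  have heq : ∀ x ∈ Ioo (-1:ℝ) 1, (Ioo (-1:ℝ) 1).piecewise σ 0 x = σ x :=
    fun x hx => piecewise_eq_of_mem _ _ _ hx
  refine ⟨(Ioo (-1:ℝ) 1).piecewise σ 0, ?_, ?_, ?_, ?_⟩
  · refine ContinuousOn.measurable_piecewise ?_ continuousOn_const measurableSet_Ioo
    exact fun x hx => (hder x hx).continuousAt.continuousWithinAt
  · intro x hx
    exact (hder x hx).congr_of_eventuallyEq
      (eventually_of_mem (isOpen_Ioo.mem_nhds hx) heq)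
  · have hlim : Tendsto (fun x : ℝ => -(Real.log (1 - x) / C)) (nhdsWithin 1 (Ioo (-1) 1)) atTop := by
      have h1 : Tendsto (fun x : ℝ => 1 - x) (nhdsWithin 1 (Ioo (-1) 1)) (nhdsWithin 0 (Ioi 0)) := by
        refine tendsto_nhdsWithin_iff.2 ⟨?_, ?_⟩
        · have : Continuous fun x : ℝ => 1 - x := by fun_prop
          simpa using (this.tendsto 1).mono_left nhdsWithin_le_nhds
        · filter_upwards [self_mem_nhdsWithin] with x hx
          simpa using hx.2
      exact tendsto_neg_atBot_atTop.comp
        ((Real.tendsto_log_nhdsGT_zero.comp h1).atBot_div_const hC)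
    refine tendsto_atTop_mono' _ ?_ hlim
    filter_upwards [self_mem_nhdsWithin, nhdsWithin_le_nhds (Ioi_mem_nhds (zero_lt_one (α := ℝ)))]
      with x hx hx0
    rw [heq x hx]
    exact (hright x ⟨le_of_lt hx0, hx.2⟩).trans (le_abs_self _)
  · have hlim : Tendsto (fun x : ℝ => -(Real.log (1 + x) / C)) (nhdsWithin (-1) (Ioo (-1) 1))
        atTop := by
      have h1 : Tendsto (fun x : ℝ => 1 + x) (nhdsWithin (-1) (Ioo (-1) 1))
          (nhdsWithin 0 (Ioi 0)) := by
        refine tendsto_nhdsWithin_iff.2 ⟨?_, ?_⟩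
        · have : Continuous fun x : ℝ => 1 + x := by fun_prop
          simpa using (this.tendsto (-1)).mono_left nhdsWithin_le_nhds
        · filter_upwards [self_mem_nhdsWithin] with x hx
          simpa [neg_lt_iff_pos_add'] using hx.1
      exact tendsto_neg_atBot_atTop.comp
        ((Real.tendsto_log_nhdsGT_zero.comp h1).atBot_div_const hC)
    refine tendsto_atTop_mono' _ ?_ hlim
    filter_upwards [self_mem_nhdsWithin,
      nhdsWithin_le_nhds (Iio_mem_nhds (by norm_num : (-1:ℝ) < 0))] with x hx hx0
    rw [heq x hx]
    have := hleft x ⟨hx.1, le_of_lt hx0⟩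
    exact (neg_le_neg this).trans (neg_le_abs _)

open Classical in
/-- Green kernel of `L_k` in terms of a cylindrical coordinate `τ`. -/
noncomputable def greenKernel_s9 (k : ℕ) (τ : ℝ → ℝ) (x y : ℝ) : ℝ :=
  if x ∈ Ioo (-1:ℝ) 1 ∧ y ∈ Ioo (-1:ℝ) 1 then Real.exp (-(k * |τ x - τ y|)) / (2 * k) else 0

theorem greenKernel_of_mem {k : ℕ} {τ : ℝ → ℝ} {x y : ℝ} (hx : x ∈ Ioo (-1:ℝ) 1)
    (hy : y ∈ Ioo (-1:ℝ) 1) :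
    greenKernel_s9 k τ x y = Real.exp (-(k * |τ x - τ y|)) / (2 * k) := if_pos ⟨hx, hy⟩

theorem greenKernel_of_notMem_left {k : ℕ} {τ : ℝ → ℝ} {x y : ℝ} (hx : x ∉ Ioo (-1:ℝ) 1) :
    greenKernel_s9 k τ x y = 0 := if_neg fun h => hx h.1

theorem greenKernel_symm (k : ℕ) (τ : ℝ → ℝ) (x y : ℝ) :
    greenKernel_s9 k τ x y = greenKernel_s9 k τ y x := by
  simp only [greenKernel_s9, and_comm, abs_sub_comm]

theorem abs_greenKernel_le (k : ℕ) (τ : ℝ → ℝ) (x y : ℝ) :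
    |greenKernel_s9 k τ x y| ≤ 1 / (2 * k) := by
  unfold greenKernel_s9
  split_ifs with h
  · rw [abs_of_nonneg (by positivity)]
    gcongr
    exact Real.exp_le_one_iff.2 (by simp only [Left.neg_nonpos_iff]; positivity)
  · simp only [abs_zero]; positivity

theorem measurable_greenKernel (k : ℕ) {τ : ℝ → ℝ} (hτ : Measurable τ) :
    Measurable (Function.uncurry (greenKernel_s9 k τ)) := by
  unfold greenKernel_s9 Function.uncurry
  refine Measurable.ite ?_ ?_ measurable_const
  · exact (measurableSet_Ioo.preimage measurable_fst).inter
      (measurableSet_Ioo.preimage measurable_snd)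
  · fun_prop

theorem tendsto_greenKernel {f τ : ℝ → ℝ} (hτ : IsCylCoord f τ) {k : ℕ} (hk : 1 ≤ k) {x₀ y : ℝ}
    (hx₀ : x₀ ∈ Icc (-1:ℝ) 1) (hy : y ∈ Ioo (-1:ℝ) 1) :
    Tendsto (fun x => greenKernel_s9 k τ x y) (nhds x₀) (nhds (greenKernel_s9 k τ x₀ y)) := by
  by_cases hx : x₀ ∈ Ioo (-1:ℝ) 1
  · have hc := (hτ.hasDerivAt x₀ hx).continuousAt
    have h1 : ContinuousAt (fun x => Real.exp (-(k * |τ x - τ y|)) / (2 * k)) x₀ := by fun_prop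
    refine (h1.congr ?_ : ContinuousAt (fun x => greenKernel_s9 k τ x y) x₀)
    filter_upwards [isOpen_Ioo.mem_nhds hx] with x hx
    rw [greenKernel_of_mem hx hy]
  · rw [greenKernel_of_notMem_left hx]
    have habs : Tendsto (fun x => |τ x|) (nhdsWithin x₀ (Ioo (-1) 1)) atTop := by
      rcases eq_or_lt_of_le hx₀.1 with rfl | h1
      · exact hτ.tendsto_neg_one
      rcases eq_or_lt_of_le hx₀.2 with rfl | h2
      · exact hτ.tendsto_one
      exact absurd ⟨h1, h2⟩ hx
    have hin : Tendsto (fun x => greenKernel_s9 k τ x y) (nhdsWithin x₀ (Ioo (-1) 1)) (nhds 0) := by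
      have h1 : Tendsto (fun x => (k:ℝ) * |τ x - τ y|) (nhdsWithin x₀ (Ioo (-1) 1)) atTop := by
        refine Tendsto.const_mul_atTop (by exact_mod_cast hk) ?_
        refine tendsto_atTop_mono (fun x => ?_) (tendsto_atTop_add_const_right _ (-|τ y|) habs)
        have := abs_sub_abs_le_abs_sub (τ x) (τ y)
        linarith
      have h2 : Tendsto (fun x => Real.exp (-(k * |τ x - τ y|)) / (2 * k))
          (nhdsWithin x₀ (Ioo (-1) 1)) (nhds 0) := by
        simpa using (Real.tendsto_exp_neg_atTop_nhds_zero.comp h1).div_const (2 * (k:ℝ))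
      refine h2.congr' ?_
      filter_upwards [self_mem_nhdsWithin] with x hx
      rw [greenKernel_of_mem hx hy]
    have hout : Tendsto (fun x => greenKernel_s9 k τ x y) (nhdsWithin x₀ (Ioo (-1) 1)ᶜ) (nhds 0) := by
      refine tendsto_const_nhds.congr' ?_
      filter_upwards [self_mem_nhdsWithin] with x hx
      rw [greenKernel_of_notMem_left hx]
    have := hin.sup hout
    rwa [← nhdsWithin_union, union_compl_self, nhdsWithin_univ] at this

/-- The Green operator of `L_k`. -/
noncomputable def greenOp (k : ℕ) (τ q : ℝ → ℝ) (x : ℝ) : ℝ :=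
  ∫ y in (-1:ℝ)..1, greenKernel_s9 k τ x y * q y

theorem greenOp_of_notMem {k : ℕ} {τ q : ℝ → ℝ} {x : ℝ} (hx : x ∉ Ioo (-1:ℝ) 1) :
    greenOp k τ q x = 0 := by
  simp [greenOp, greenKernel_of_notMem_left hx]

theorem continuousOn_greenOp {f τ q : ℝ → ℝ} (hτ : IsCylCoord f τ) {k : ℕ} (hk : 1 ≤ k)
    (hq : ContinuousOn q (Icc (-1) 1)) : ContinuousOn (greenOp k τ q) (Icc (-1) 1) := by
  intro x₀ hx₀
  have hqi : IntervalIntegrable q volume (-1) 1 :=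
    ContinuousOn.intervalIntegrable (by rwa [uIcc_of_le (by norm_num)])
  refine ContinuousAt.continuousWithinAt ?_
  refine tendsto_integral_filter_of_dominated_convergence
    (fun y => 1 / (2 * (k:ℝ)) * ‖q y‖) ?_ ?_ (hqi.norm.const_mul _) ?_
  · refine Eventually.of_forall fun x => ?_
    have : Measurable (greenKernel_s9 k τ x) :=
      (measurable_greenKernel k hτ.measurable).comp measurable_prodMk_left
    exact this.aestronglyMeasurable.mul hqi.def'.aestronglyMeasurable
  · refine Eventually.of_forall fun x => Eventually.of_forall fun y _ => ?_
    rw [norm_mul]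
    gcongr
    exact abs_greenKernel_le k τ x y
  · have : ∀ᵐ y : ℝ, y ≠ 1 := by simp [ae_iff]
    filter_upwards [this] with y hy hmem
    rw [uIoc_of_le (by norm_num)] at hmem
    exact (tendsto_greenKernel hτ hk hx₀ ⟨hmem.1, lt_of_le_of_ne hmem.2 hy⟩).mul_const _

theorem IsCylCoord.monotoneOn {f τ : ℝ → ℝ} (hτ : IsCylCoord f τ) (hf : IsProfile f) :
    MonotoneOn τ (Ioo (-1) 1) := by
  refine monotoneOn_of_deriv_nonneg (convex_Ioo _ _)
    (fun y hy => (hτ.hasDerivAt y hy).continuousAt.continuousWithinAt)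
    (fun y hy => (hτ.hasDerivAt y (interior_subset hy)).differentiableAt.differentiableWithinAt) ?_
  intro y hy
  rw [(hτ.hasDerivAt y (interior_subset hy)).deriv]
  have := hf.pos y (interior_subset hy)
  positivity

/-- `greenOp k τ q` solves `L_k h = q`, written as a first order system for `h` and its bounded
flux `f h'`. -/
theorem exists_flux_greenOp {f τ q : ℝ → ℝ} (hf : IsProfile f) (hτ : IsCylCoord f τ) {k : ℕ}
    (hk : 1 ≤ k) (hq : ContinuousOn q (Icc (-1) 1)) :
    ∃ F : ℝ → ℝ, (∃ C, ∀ x ∈ Ioo (-1:ℝ) 1, |F x| ≤ C) ∧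
      (∀ x ∈ Ioo (-1:ℝ) 1, HasDerivAt (greenOp k τ q) (F x / f x) x) ∧
      ∀ x ∈ Ioo (-1:ℝ) 1, HasDerivAt F ((k:ℝ) ^ 2 / f x * greenOp k τ q x - q x) x := by
  obtain ⟨B, hB⟩ := isCompact_Icc.exists_bound_of_continuousOn hq
  have hB0 : 0 ≤ B := (norm_nonneg _).trans (hB 0 (by simp))
  have hk0 : (0:ℝ) < k := by exact_mod_cast hk
  have hmono := hτ.monotoneOn hf
  set p : ℝ → ℝ := fun x => Real.exp (k * τ x) with hp
  set r : ℝ → ℝ := fun x => Real.exp (-(k * τ x)) with hr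
  have hpm : Measurable p := (hτ.measurable.const_mul _).exp
  have hrm : Measurable r := (hτ.measurable.const_mul _).neg.exp
  have hpr : ∀ x, p x * r x = 1 := fun x => by simp [hp, hr, ← Real.exp_add]
  have hpd : ∀ x ∈ Ioo (-1:ℝ) 1, HasDerivAt p (p x * (k * (1 / f x))) x :=
    fun x hx => ((hτ.hasDerivAt x hx).const_mul (k:ℝ)).exp
  have hrd : ∀ x ∈ Ioo (-1:ℝ) 1, HasDerivAt r (r x * -(k * (1 / f x))) x :=
    fun x hx => ((hτ.hasDerivAt x hx).const_mul (k:ℝ)).fun_neg.exp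
  have hqi : IntervalIntegrable q volume (-1) 1 :=
    ContinuousOn.intervalIntegrable (by rwa [uIcc_of_le (by norm_num)])
  have hqm : AEStronglyMeasurable q (volume.restrict (Icc (-1) 1)) :=
    hq.aestronglyMeasurable measurableSet_Icc
  have hPb : ∀ x ∈ Ioo (-1:ℝ) 1, ∀ y ∈ Ioc (-1:ℝ) x, ‖p y * q y‖ ≤ p x * B := by
    intro x hx y hy
    have hyI : y ∈ Ioo (-1:ℝ) 1 := ⟨hy.1, hy.2.trans_lt hx.2⟩
    rw [norm_mul, Real.norm_of_nonneg (Real.exp_nonneg _)]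
    refine mul_le_mul ?_ (hB y ⟨hyI.1.le, hyI.2.le⟩) (norm_nonneg _) (Real.exp_nonneg _)
    exact Real.exp_le_exp.2 (mul_le_mul_of_nonneg_left (hmono hyI hx hy.2) hk0.le)
  have hQb : ∀ x ∈ Ioo (-1:ℝ) 1, ∀ y ∈ Ioo x (1:ℝ), ‖r y * q y‖ ≤ r x * B := by
    intro x hx y hy
    have hyI : y ∈ Ioo (-1:ℝ) 1 := ⟨hx.1.trans hy.1, hy.2⟩
    rw [norm_mul, Real.norm_of_nonneg (Real.exp_nonneg _)]
    refine mul_le_mul ?_ (hB y ⟨hyI.1.le, hyI.2.le⟩) (norm_nonneg _) (Real.exp_nonneg _)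
    exact Real.exp_le_exp.2 (neg_le_neg (mul_le_mul_of_nonneg_left (hmono hx hyI hy.1.le) hk0.le))
  have hne1 : ∀ᵐ y : ℝ, y ≠ 1 := by simp [ae_iff]
  have hPi : ∀ x ∈ Ioo (-1:ℝ) 1, IntervalIntegrable (fun y => p y * q y) volume (-1) x := by
    intro x hx
    rw [intervalIntegrable_iff_integrableOn_Ioc_of_le hx.1.le]
    refine Integrable.mono' (integrable_const (p x * B)) ?_ ?_
    · exact hpm.aestronglyMeasurable.mul (hqm.mono_measure (Measure.restrict_mono
        (Ioc_subset_Icc_self.trans (Icc_subset_Icc_right hx.2.le)) le_rfl))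
    · exact (ae_restrict_mem measurableSet_Ioc).mono (hPb x hx)
  have hQi : ∀ x ∈ Ioo (-1:ℝ) 1, IntervalIntegrable (fun y => r y * q y) volume x 1 := by
    intro x hx
    rw [intervalIntegrable_iff_integrableOn_Ioo_of_le hx.2.le]
    refine Integrable.mono' (integrable_const (r x * B)) ?_ ?_
    · exact hrm.aestronglyMeasurable.mul (hqm.mono_measure (Measure.restrict_mono
        (Ioo_subset_Icc_self.trans (Icc_subset_Icc_left hx.1.le)) le_rfl))
    · exact (ae_restrict_mem measurableSet_Ioo).mono (hQb x hx)
  set P : ℝ → ℝ := fun x => ∫ y in (-1:ℝ)..x, p y * q y with hP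
  set Q : ℝ → ℝ := fun x => ∫ y in x..(1:ℝ), r y * q y with hQ
  have hqc : ContinuousOn q (Ioo (-1) 1) := hq.mono Ioo_subset_Icc_self
  have hPd : ∀ x ∈ Ioo (-1:ℝ) 1, HasDerivAt P (p x * q x) x := by
    intro x hx
    have hc : ContinuousOn (fun y => p y * q y) (Ioo (-1) 1) := ContinuousOn.mul
      (fun y hy => (hpd y hy).continuousAt.continuousWithinAt) hqc
    exact integral_hasDerivAt_right (hPi x hx) (hc.stronglyMeasurableAtFilter isOpen_Ioo x hx)
      (hc.continuousAt (isOpen_Ioo.mem_nhds hx))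
  have hQd : ∀ x ∈ Ioo (-1:ℝ) 1, HasDerivAt Q (-(r x * q x)) x := by
    intro x hx
    have hc : ContinuousOn (fun y => r y * q y) (Ioo (-1) 1) := ContinuousOn.mul
      (fun y hy => (hrd y hy).continuousAt.continuousWithinAt) hqc
    exact integral_hasDerivAt_left (hQi x hx) (hc.stronglyMeasurableAtFilter isOpen_Ioo x hx)
      (hc.continuousAt (isOpen_Ioo.mem_nhds hx))
  have hrep : ∀ x ∈ Ioo (-1:ℝ) 1,
      greenOp k τ q x = (r x * P x + p x * Q x) / (2 * k) := by
    intro x hx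
    have e1 : ∫ y in (-1:ℝ)..x, greenKernel_s9 k τ x y * q y = r x / (2 * k) * P x := by
      rw [hP, ← intervalIntegral.integral_const_mul]
      refine integral_congr_ae (Eventually.of_forall fun y hy => ?_)
      rw [uIoc_of_le hx.1.le] at hy
      have hyI : y ∈ Ioo (-1:ℝ) 1 := ⟨hy.1, hy.2.trans_lt hx.2⟩
      rw [greenKernel_of_mem hx hyI, abs_of_nonneg (sub_nonneg.2 (hmono hyI hx hy.2)),
        show -((k:ℝ) * (τ x - τ y)) = -(k * τ x) + k * τ y by ring, Real.exp_add]
      simp only [hp, hr]; ring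
    have e2 : ∫ y in x..(1:ℝ), greenKernel_s9 k τ x y * q y = p x / (2 * k) * Q x := by
      rw [hQ, ← intervalIntegral.integral_const_mul]
      refine integral_congr_ae (hne1.mono fun y hy1 hy => ?_)
      rw [uIoc_of_le hx.2.le] at hy
      have hyI : y ∈ Ioo (-1:ℝ) 1 := ⟨hx.1.trans hy.1, lt_of_le_of_ne hy.2 hy1⟩
      rw [greenKernel_of_mem hx hyI, abs_of_nonpos (sub_nonpos.2 (hmono hx hyI hy.1.le)),
        show -((k:ℝ) * -(τ x - τ y)) = k * τ x + -(k * τ y) by ring, Real.exp_add]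
      simp only [hp, hr]; ring
    have hi : IntervalIntegrable (fun y => greenKernel_s9 k τ x y * q y) volume (-1) 1 := by
      refine (hqi.norm.const_mul (1 / (2 * (k:ℝ)))).mono_fun ?_ ?_
      · have : Measurable (greenKernel_s9 k τ x) :=
          (measurable_greenKernel k hτ.measurable).comp measurable_prodMk_left
        exact this.aestronglyMeasurable.mul hqi.def'.aestronglyMeasurable
      · refine Eventually.of_forall fun y => ?_
        simp only [norm_mul, norm_norm]
        gcongr
        exact (abs_greenKernel_le k τ x y).trans (le_abs_self _)
    have hsub1 : uIcc (-1) x ⊆ uIcc (-1:ℝ) 1 := by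
      rw [uIcc_of_le hx.1.le, uIcc_of_le (by norm_num)]; exact Icc_subset_Icc_right hx.2.le
    have hsub2 : uIcc x 1 ⊆ uIcc (-1:ℝ) 1 := by
      rw [uIcc_of_le hx.2.le, uIcc_of_le (by norm_num)]; exact Icc_subset_Icc_left hx.1.le
    rw [greenOp, ← integral_add_adjacent_intervals (hi.mono_set hsub1) (hi.mono_set hsub2), e1, e2]
    ring
  refine ⟨fun x => (p x * Q x - r x * P x) / 2, ⟨B * 2, fun x hx => ?_⟩, fun x hx => ?_,
    fun x hx => ?_⟩
  · have hP' : ‖P x‖ ≤ p x * B * |x - -1| := norm_integral_le_of_norm_le_const (by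
      rw [uIoc_of_le hx.1.le]; exact hPb x hx)
    have hQ' : ‖Q x‖ ≤ r x * B * |1 - x| := norm_integral_le_of_norm_le_const_ae (by
      filter_upwards [hne1] with y hy1 hy
      rw [uIoc_of_le hx.2.le] at hy
      exact hQb x hx y ⟨hy.1, lt_of_le_of_ne hy.2 hy1⟩)
    rw [abs_of_nonneg (by linarith [hx.1])] at hP'
    rw [abs_of_nonneg (by linarith [hx.2])] at hQ'
    have hp0 : 0 ≤ p x := Real.exp_nonneg _
    have hr0 : 0 ≤ r x := Real.exp_nonneg _
    have h1 : |r x * P x| ≤ B * (x + 1) := by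
      rw [abs_mul, abs_of_nonneg hr0]
      calc r x * |P x| ≤ r x * (p x * B * (x - -1)) := mul_le_mul_of_nonneg_left hP' hr0
        _ = (p x * r x) * (B * (x + 1)) := by ring
        _ = _ := by rw [hpr, one_mul]
    have h2 : |p x * Q x| ≤ B * (1 - x) := by
      rw [abs_mul, abs_of_nonneg hp0]
      calc p x * |Q x| ≤ p x * (r x * B * (1 - x)) := mul_le_mul_of_nonneg_left hQ' hp0
        _ = (p x * r x) * (B * (1 - x)) := by ring
        _ = _ := by rw [hpr, one_mul]
    rw [abs_div, abs_two]
    have := abs_sub (p x * Q x) (r x * P x)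
    linarith
  · have h := ((((hrd x hx).mul (hPd x hx)).add ((hpd x hx).mul (hQd x hx))).div_const (2 * (k:ℝ)))
    have h' := h.congr_of_eventuallyEq (f₁ := greenOp k τ q)
      (eventually_of_mem (isOpen_Ioo.mem_nhds hx) hrep)
    have hfx := (hf.pos x hx).ne'
    refine h'.congr_deriv ?_
    field_simp
    ring
  · have h := ((((hpd x hx).mul (hQd x hx)).sub ((hrd x hx).mul (hPd x hx))).div_const 2)
    have hfx := (hf.pos x hx).ne'
    refine h.congr_deriv ?_
    rw [hrep x hx]
    have := hpr x
    field_simp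
    linear_combination (-2 * q x * f x) * this

theorem exists_greenOp_top_eigenfunction {f τ : ℝ → ℝ} (hτ : IsCylCoord f τ) {k : ℕ}
    (hk : 1 ≤ k) :
    ∃ M : ℝ, 0 < M ∧
      (∃ u : ℝ → ℝ, ContinuousOn u (Icc (-1) 1) ∧ (∃ x ∈ Ioo (-1:ℝ) 1, u x ≠ 0) ∧
        ∀ x ∈ Icc (-1:ℝ) 1, greenOp k τ u x = M * u x) ∧
      ∀ φ : ℝ → ℝ, ContinuousOn φ (Icc (-1) 1) →
        ∫ x in (-1:ℝ)..1, greenOp k τ φ x * φ x ≤ M * ∫ x in (-1:ℝ)..1, φ x ^ 2 := by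
  set K := Icc (-1:ℝ) 1
  set μ : Measure K := Measure.comap Subtype.val volume with hμ
  have hint : ∀ g : ℝ → ℝ, ∫ x : K, g x ∂μ = ∫ x in (-1:ℝ)..1, g x := by
    intro g
    rw [hμ, integral_subtype_comap measurableSet_Icc, integral_of_le (by norm_num),
      integral_Icc_eq_integral_Ioc]
  have hfin : IsFiniteMeasure μ := by
    refine ⟨?_⟩
    rw [hμ, comap_subtype_coe_apply measurableSet_Icc, image_univ, Subtype.range_coe]
    exact measure_Icc_lt_top
  have hae : ∀ᵐ y : K ∂μ, (y : ℝ) ∈ Ioo (-1:ℝ) 1 := by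
    have h : ∀ᵐ y ∂(volume.restrict K), y ∈ Ioo (-1:ℝ) 1 := by
      rw [← restrict_Ioo_eq_restrict_Icc]
      exact ae_restrict_mem measurableSet_Ioo
    rw [← map_comap_subtype_coe measurableSet_Icc] at h
    exact ae_of_ae_map measurable_subtype_coe.aemeasurable h
  have hk0 : (0:ℝ) < k := by exact_mod_cast hk
  have hpos : 0 < ∫ x : K, ∫ y : K, greenKernel_s9 k τ x y ∂μ ∂μ := by
    simp_rw [hint]
    rw [hint (fun x => ∫ y in (-1:ℝ)..1, greenKernel_s9 k τ x y)]
    have heq : (fun x => ∫ y in (-1:ℝ)..1, greenKernel_s9 k τ x y) = greenOp k τ 1 := by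
      ext x; simp [greenOp]
    rw [heq]
    refine intervalIntegral_pos_of_pos_on ?_ ?_ (by norm_num)
    · refine ContinuousOn.intervalIntegrable ?_
      rw [uIcc_of_le (by norm_num)]
      exact continuousOn_greenOp hτ hk continuousOn_const
    · intro x hx
      rw [← heq]
      refine intervalIntegral_pos_of_pos_on ?_ ?_ (by norm_num)
      · refine (intervalIntegrable_const (c := 1 / (2 * (k:ℝ)))).mono_fun ?_ ?_
        · have : Measurable (greenKernel_s9 k τ x) :=
            (measurable_greenKernel k hτ.measurable).comp measurable_prodMk_left
          exact this.aestronglyMeasurable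
        · exact Eventually.of_forall fun y => (abs_greenKernel_le k τ x y).trans (le_abs_self _)
      · intro y hy
        rw [greenKernel_of_mem hx hy]
        positivity
  obtain ⟨M, hM, ⟨u, ⟨x₀, hx₀⟩, hu⟩, hle⟩ := exists_kernel_top_eigenfunction μ
    (fun x y : K => greenKernel_s9 k τ x y)
    ((measurable_greenKernel k hτ.measurable).comp
      (measurable_subtype_coe.prodMap measurable_subtype_coe))
    (fun x y => greenKernel_symm k τ x y) (1 / (2 * k)) (fun x y => abs_greenKernel_le k τ x y)
    (fun x₀ => hae.mono fun y hy =>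
      (tendsto_greenKernel hτ hk x₀.2 hy).comp continuous_subtype_val.continuousAt) hpos
  have h11 : (-1:ℝ) ≤ 1 := by norm_num
  have hup : ∀ x : K, IccExtend h11 u x = u x := fun x => IccExtend_val _ _ _
  have heig : ∀ x ∈ Icc (-1:ℝ) 1, greenOp k τ (IccExtend h11 u) x = M * IccExtend h11 u x := by
    intro x hx
    have h := hu ⟨x, hx⟩
    rw [← hup] at h
    rw [← h, greenOp, ← hint]
    simp only [hup]
  refine ⟨M, hM, ⟨IccExtend h11 u, u.continuous.Icc_extend'.continuousOn, ⟨x₀, ?_, ?_⟩, heig⟩, ?_⟩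
  · by_contra h
    have := heig x₀ x₀.2
    rw [greenOp_of_notMem h, hup] at this
    exact mul_ne_zero hM.ne' hx₀ this.symm
  · rwa [hup]
  · intro φ hφ
    have h : ∫ x : K, (∫ y : K, greenKernel_s9 k τ x y * φ y ∂μ) * φ x ∂μ ≤
        M * ∫ x : K, φ x ^ 2 ∂μ := hle ⟨K.domRestrict φ, hφ.domRestrict⟩
    rw [hint (fun x => φ x ^ 2)] at h
    simp_rw [fun x : K => hint (fun y => greenKernel_s9 k τ x y * φ y)] at h
    rwa [hint (fun x => (∫ y in (-1:ℝ)..1, greenKernel_s9 k τ x y * φ y) * φ x)] at h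

theorem continuousOn_mul_of_bdd {F ψ : ℝ → ℝ} {C : ℝ} (hF : ContinuousOn F (Ioo (-1) 1))
    (hC : ∀ x ∈ Ioo (-1:ℝ) 1, |F x| ≤ C) (hψ : ContinuousOn ψ (Icc (-1) 1)) (h1 : ψ (-1) = 0)
    (h2 : ψ 1 = 0) : ContinuousOn (fun x => F x * ψ x) (Icc (-1) 1) := by
  intro x hx
  by_cases hxI : x ∈ Ioo (-1:ℝ) 1
  · exact ((hF.continuousAt (isOpen_Ioo.mem_nhds hxI)).mul
      (hψ.continuousAt (Icc_mem_nhds hxI.1 hxI.2))).continuousWithinAt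
  · have hend : ∀ y ∈ Icc (-1:ℝ) 1, y ∉ Ioo (-1:ℝ) 1 → ψ y = 0 := by
      intro y hy hyI
      rcases eq_or_lt_of_le hy.1 with rfl | h3
      · exact h1
      rcases eq_or_lt_of_le hy.2 with rfl | h4
      · exact h2
      exact absurd ⟨h3, h4⟩ hyI
    have hx0 := hend x hx hxI
    have hlim := hψ x hx
    rw [ContinuousWithinAt, hx0] at hlim
    rw [ContinuousWithinAt, hx0, mul_zero]
    have hlim' : Tendsto (fun y => C * |ψ y|) (nhdsWithin x (Icc (-1) 1)) (nhds 0) := by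
      simpa using hlim.abs.const_mul C
    refine squeeze_zero_norm' ?_ hlim'
    filter_upwards [self_mem_nhdsWithin] with y hy
    rw [norm_mul]
    by_cases hyI : y ∈ Ioo (-1:ℝ) 1
    · exact mul_le_mul_of_nonneg_right (hC y hyI) (norm_nonneg _)
    · simp [hend y hy hyI]

/-- The lowest eigenvalue of `L_k`, `k ≥ 1`, characterised by a family of lower bounds for the
energy of test functions. -/
def IsGroundEnergy (f : ℝ → ℝ) (k : ℕ) (lam : ℝ) : Prop :=
  ∀ φ φ' B B' q : ℝ → ℝ, ContinuousOn φ (Icc (-1) 1) → φ (-1) = 0 → φ 1 = 0 →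
    (∀ x ∈ Ioo (-1:ℝ) 1, HasDerivAt φ (φ' x) x) →
    ContinuousOn B (Icc (-1) 1) → B (-1) = 0 → B 1 = 0 →
    (∀ x ∈ Ioo (-1:ℝ) 1, HasDerivAt B (B' x) x) →
    IntervalIntegrable q volume (-1) 1 →
    (∀ x ∈ Ioo (-1:ℝ) 1, f x * φ' x ^ 2 + (k:ℝ) ^ 2 / f x * φ x ^ 2 ≤ q x + B' x) →
    lam * ∫ x in (-1:ℝ)..1, φ x ^ 2 ≤ ∫ x in (-1:ℝ)..1, q x

theorem isGroundEnergy_of_greenOp_le {f τ : ℝ → ℝ} (hf : IsProfile f) (hτ : IsCylCoord f τ)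
    {k : ℕ} (hk : 1 ≤ k) {M : ℝ} (hM : 0 < M)
    (hle : ∀ φ : ℝ → ℝ, ContinuousOn φ (Icc (-1) 1) →
      ∫ x in (-1:ℝ)..1, greenOp k τ φ x * φ x ≤ M * ∫ x in (-1:ℝ)..1, φ x ^ 2) :
    IsGroundEnergy f k M⁻¹ := by
  intro φ φ' B B' q hφ hφ1 hφ2 hφd hB hB1 hB2 hBd hq hineq
  obtain ⟨F, ⟨C, hC⟩, hhd, hFd⟩ := exists_flux_greenOp hf hτ hk hφ
  set s := M⁻¹ with hs
  have hs0 : 0 < s := inv_pos.2 hM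
  have hhc := continuousOn_greenOp hτ hk hφ
  have hle' := hle φ hφ
  have hh1 : greenOp k τ φ (-1) = 0 := greenOp_of_notMem (by simp)
  have hh2 : greenOp k τ φ 1 = 0 := greenOp_of_notMem (by simp)
  set h := greenOp k τ φ
  have h11 : (-1:ℝ) ≤ 1 := by norm_num
  have hii : ∀ g : ℝ → ℝ, ContinuousOn g (Icc (-1) 1) → IntervalIntegrable g volume (-1) 1 :=
    fun g hg => ContinuousOn.intervalIntegrable (by rwa [uIcc_of_le h11])
  have i1 : IntervalIntegrable (fun x => 2 * s * φ x ^ 2) volume (-1) 1 :=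
    (hii _ (hφ.pow 2)).const_mul _
  have i2 : IntervalIntegrable (fun x => s ^ 2 * (h x * φ x)) volume (-1) 1 :=
    (hii _ (hhc.mul hφ)).const_mul _
  have hFc : ContinuousOn F (Ioo (-1) 1) :=
    fun x hx => (hFd x hx).continuousAt.continuousWithinAt
  have key := sub_le_integral_of_hasDeriv_right_of_le (a := -1) (b := 1)
    (g := fun x => F x * (2 * s * φ x - s ^ 2 * h x) - B x)
    (g' := fun x => ((k:ℝ) ^ 2 / f x * h x - φ x) * (2 * s * φ x - s ^ 2 * h x) +
      F x * (2 * s * φ' x - s ^ 2 * (F x / f x)) - B' x)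
    (φ := fun x => q x - 2 * s * φ x ^ 2 + s ^ 2 * (h x * φ x)) h11
    ((continuousOn_mul_of_bdd hFc hC
      ((hφ.const_mul (2 * s)).sub (hhc.const_mul (s ^ 2))) (by simp [hφ1, hh1])
      (by simp [hφ2, hh2])).sub hB)
    (fun x hx => (((hFd x hx).mul (((hφd x hx).const_mul (2 * s)).sub
      ((hhd x hx).const_mul (s ^ 2)))).sub (hBd x hx)).hasDerivWithinAt)
    ((intervalIntegrable_iff_integrableOn_Icc_of_le h11).1 ((hq.sub i1).add i2))
    (fun x hx => by
      have hfx := hf.pos x hx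
      have e1 : 0 ≤ (f x * φ' x - s * F x) ^ 2 / f x := by positivity
      have e2 : 0 ≤ (k:ℝ) ^ 2 / f x * (φ x - s * h x) ^ 2 := by positivity
      have e3 : (f x * φ' x - s * F x) ^ 2 / f x =
          f x * φ' x ^ 2 - 2 * s * F x * φ' x + s ^ 2 * (F x * (F x / f x)) := by
        field_simp; ring
      have e4 := hineq x hx
      rw [e3] at e1
      nlinarith)
  rw [intervalIntegral.integral_add (hq.sub i1) i2, intervalIntegral.integral_sub hq i1,
    intervalIntegral.integral_const_mul, intervalIntegral.integral_const_mul] at key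
  simp only [hφ1, hφ2, hh1, hh2, hB1, hB2] at key
  have e5 : s ^ 2 * ∫ x in (-1:ℝ)..1, h x * φ x ≤ s * ∫ x in (-1:ℝ)..1, φ x ^ 2 := by
    calc s ^ 2 * ∫ x in (-1:ℝ)..1, h x * φ x ≤ s ^ 2 * (M * ∫ x in (-1:ℝ)..1, φ x ^ 2) := by
          gcongr
      _ = _ := by rw [hs]; field_simp
  linarith

theorem contDiffOn_of_flux {f u F : ℝ → ℝ} (hf : IsProfile f) {k : ℕ} {lam : ℝ}
    (hu : ∀ x ∈ Ioo (-1:ℝ) 1, HasDerivAt u (F x / f x) x)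
    (hF : ∀ x ∈ Ioo (-1:ℝ) 1, HasDerivAt F ((k:ℝ) ^ 2 / f x * u x - lam * u x) x) :
    ContDiffOn ℝ (⊤ : ℕ∞) u (Ioo (-1) 1) := by
  have key : ∀ n : ℕ, ContDiffOn ℝ n u (Ioo (-1) 1) ∧ ContDiffOn ℝ n F (Ioo (-1) 1) := by
    intro n
    induction n with
    | zero =>
      simp only [Nat.cast_zero, contDiffOn_zero]
      exact ⟨fun x hx => (hu x hx).continuousAt.continuousWithinAt,
        fun x hx => (hF x hx).continuousAt.continuousWithinAt⟩
    | succ n ih =>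
      have hfn : ContDiffOn ℝ n f (Ioo (-1) 1) := hf.smoothOn.of_le (by exact_mod_cast le_top)
      have hne : ∀ x ∈ Ioo (-1:ℝ) 1, f x ≠ 0 := fun x hx => (hf.pos x hx).ne'
      constructor
      · rw [Nat.cast_succ, contDiffOn_succ_iff_deriv_of_isOpen isOpen_Ioo]
        refine ⟨fun x hx => (hu x hx).differentiableAt.differentiableWithinAt, by simp, ?_⟩
        exact (ih.2.div hfn hne).congr fun x hx => (hu x hx).deriv
      · rw [Nat.cast_succ, contDiffOn_succ_iff_deriv_of_isOpen isOpen_Ioo]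
        refine ⟨fun x hx => (hF x hx).differentiableAt.differentiableWithinAt, by simp, ?_⟩
        exact (((contDiffOn_const.div hfn hne).mul ih.1).sub (contDiffOn_const.mul ih.1)).congr
          fun x hx => (hF x hx).deriv
  exact contDiffOn_infty.2 fun n => (key n).1

theorem inSpec_of_flux {f u F : ℝ → ℝ} (hf : IsProfile f) {k : ℕ} {lam : ℝ}
    (huc : ContinuousOn u (Icc (-1) 1)) (hne : ∃ x ∈ Ioo (-1:ℝ) 1, u x ≠ 0)
    (hu1 : u (-1) = 0) (hu2 : u 1 = 0)
    (hu : ∀ x ∈ Ioo (-1:ℝ) 1, HasDerivAt u (F x / f x) x)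
    (hF : ∀ x ∈ Ioo (-1:ℝ) 1, HasDerivAt F ((k:ℝ) ^ 2 / f x * u x - lam * u x) x) :
    InSpec f k lam := by
  refine ⟨u, huc, contDiffOn_of_flux hf hu hF, hne, fun _ => ⟨hu1, hu2⟩, fun x hx => ?_⟩
  have heq : (fun y => f y * deriv u y) =ᶠ[nhds x] F := by
    filter_upwards [isOpen_Ioo.mem_nhds hx] with y hy
    rw [(hu y hy).deriv, mul_div_cancel₀ _ (hf.pos y hy).ne']
  rw [heq.deriv_eq, (hF x hx).deriv]
  ring

/-- For `k ≥ 1` the operator `L_k` has a positive ground state energy, which is an eigenvalue with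
an eigenfunction of bounded flux. -/
theorem exists_groundEnergy {f : ℝ → ℝ} (hf : IsProfile f)
    (hf' : ContinuousOn (deriv f) (Icc (-1) 1)) {k : ℕ} (hk : 1 ≤ k) :
    ∃ lam : ℝ, 0 < lam ∧ InSpec f k lam ∧ IsGroundEnergy f k lam ∧
      ∃ u F : ℝ → ℝ, ContinuousOn u (Icc (-1) 1) ∧ (∃ x ∈ Ioo (-1:ℝ) 1, u x ≠ 0) ∧
        u (-1) = 0 ∧ u 1 = 0 ∧ (∃ C, ∀ x ∈ Ioo (-1:ℝ) 1, |F x| ≤ C) ∧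
        (∀ x ∈ Ioo (-1:ℝ) 1, HasDerivAt u (F x / f x) x) ∧
        ∀ x ∈ Ioo (-1:ℝ) 1, HasDerivAt F ((k:ℝ) ^ 2 / f x * u x - lam * u x) x := by
  obtain ⟨τ, hτ⟩ := hf.exists_isCylCoord hf'
  obtain ⟨M, hM, ⟨u, huc, hne, heig⟩, hle⟩ := exists_greenOp_top_eigenfunction hτ hk
  obtain ⟨F, ⟨C, hC⟩, hud, hFd⟩ := exists_flux_greenOp hf hτ hk huc
  have hu' : ∀ x ∈ Icc (-1:ℝ) 1, u x = M⁻¹ * greenOp k τ u x := by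
    intro x hx; rw [heig x hx, inv_mul_cancel_left₀ hM.ne']
  have hu1 : u (-1) = 0 := by
    rw [hu' _ (by simp), greenOp_of_notMem (by simp), mul_zero]
  have hu2 : u 1 = 0 := by
    rw [hu' _ (by simp), greenOp_of_notMem (by simp), mul_zero]
  have hud' : ∀ x ∈ Ioo (-1:ℝ) 1, HasDerivAt u (M⁻¹ * F x / f x) x := by
    intro x hx
    have h := ((hud x hx).const_mul M⁻¹).congr_of_eventuallyEq (f₁ := u)
      (eventually_of_mem (isOpen_Ioo.mem_nhds hx) fun y hy => hu' y (Ioo_subset_Icc_self hy))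
    exact h.congr_deriv (by ring)
  have hFd' : ∀ x ∈ Ioo (-1:ℝ) 1,
      HasDerivAt (fun x => M⁻¹ * F x) ((k:ℝ) ^ 2 / f x * u x - M⁻¹ * u x) x := by
    intro x hx
    refine ((hFd x hx).const_mul M⁻¹).congr_deriv ?_
    rw [heig x (Ioo_subset_Icc_self hx)]
    field_simp
  refine ⟨M⁻¹, inv_pos.2 hM, inSpec_of_flux hf huc hne hu1 hu2 hud' hFd',
    isGroundEnergy_of_greenOp_le hf hτ hk hM hle, u, fun x => M⁻¹ * F x, huc, hne, hu1, hu2,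
    ⟨M⁻¹ * C, fun x hx => ?_⟩, hud', hFd'⟩
  rw [abs_mul, abs_of_pos (inv_pos.2 hM)]
  exact mul_le_mul_of_nonneg_left (hC x hx) (inv_pos.2 hM).le

theorem exists_strictMono_eigs {f : ℝ → ℝ} (hf : IsProfile f)
    (hf' : ContinuousOn (deriv f) (Icc (-1) 1)) :
    ∃ a : ℕ → ℝ, StrictMono a ∧ (∀ k, a k ∈ Eigs f) ∧ ∀ k, 1 ≤ k → IsGroundEnergy f k (a k) := by
  choose lam hpos hspec hground hstate using
    fun k : ℕ => exists_groundEnergy hf hf' (k := k + 1) (by omega)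
  have hmono : ∀ k, lam k < lam (k + 1) := by
    intro k
    obtain ⟨u, F, huc, ⟨x₀, hx₀, hux₀⟩, hu1, hu2, ⟨C, hC⟩, hud, hFd⟩ := hstate (k + 1)
    obtain ⟨D, hD⟩ := isCompact_Icc.exists_bound_of_continuousOn hf.contOn
    have h11 : (-1:ℝ) ≤ 1 := by norm_num
    have hu2i : IntervalIntegrable (fun x => u x ^ 2) volume (-1) 1 :=
      ContinuousOn.intervalIntegrable (by rw [uIcc_of_le h11]; exact huc.pow 2)
    have hint : 0 < ∫ x in (-1:ℝ)..1, u x ^ 2 := by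
      refine integral_pos (by norm_num) (huc.pow 2) (fun x _ => sq_nonneg _)
        ⟨x₀, Ioo_subset_Icc_self hx₀, by positivity⟩
    have hFc : ContinuousOn F (Ioo (-1) 1) :=
      fun x hx => (hFd x hx).continuousAt.continuousWithinAt
    have hDpos : 0 < D := (hf.pos x₀ hx₀).trans_le
      ((le_abs_self _).trans (hD x₀ (Ioo_subset_Icc_self hx₀)))
    have key := hground k u (fun x => F x / f x) (fun x => F x * u x)
      (fun x => (((k + 1 + 1 : ℕ) : ℝ) ^ 2 / f x * u x - lam (k + 1) * u x) * u x +
        F x * (F x / f x))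
      (fun x => (lam (k + 1) - 1 / D) * u x ^ 2) huc hu1 hu2 hud
      (continuousOn_mul_of_bdd hFc hC huc hu1 hu2) (by simp [hu1]) (by simp [hu2])
      (fun x hx => (hFd x hx).mul (hud x hx)) (hu2i.const_mul _)
      (fun x hx => by
        have hfx := hf.pos x hx
        have hfD : f x ≤ D := (le_abs_self _).trans (hD x (Ioo_subset_Icc_self hx))
        have h1 : 1 / D ≤ 1 / f x := one_div_le_one_div_of_le hfx hfD
        have h2 : f x * (F x / f x) ^ 2 = F x * (F x / f x) := by field_simp
        have h3 : 0 ≤ 1 / f x := by positivity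
        rw [h2]
        push_cast
        have h4 : 0 ≤ (1 / f x * (((k:ℝ) + 1 + 1) ^ 2 - ((k:ℝ) + 1) ^ 2) - 1 / D) * u x ^ 2 := by
          refine mul_nonneg ?_ (sq_nonneg _)
          have : (1:ℝ) ≤ ((k:ℝ) + 1 + 1) ^ 2 - ((k:ℝ) + 1) ^ 2 := by
            nlinarith [Nat.cast_nonneg (α := ℝ) k]
          nlinarith
        have h5 : (((k:ℝ) + 1 + 1) ^ 2 / f x * u x - lam (k + 1) * u x) * u x =
          1 / f x * ((k:ℝ) + 1 + 1) ^ 2 * u x ^ 2 - lam (k + 1) * u x ^ 2 := by ring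
        have h6 : ((k:ℝ) + 1) ^ 2 / f x * u x ^ 2 = 1 / f x * ((k:ℝ) + 1) ^ 2 * u x ^ 2 := by ring
        rw [h5, h6]
        linarith)
    rw [intervalIntegral.integral_const_mul] at key
    have := le_of_mul_le_mul_right key hint
    have : 0 < 1 / D := by positivity
    linarith
  refine ⟨fun n => Nat.casesOn n 0 lam, strictMono_nat_of_lt_succ fun n => ?_, fun n => ?_,
    fun n hn => ?_⟩
  · cases n with
    | zero => exact hpos 0
    | succ n => exact hmono n
  · cases n with
    | zero =>
      refine mem_iUnion.2 ⟨0, fun _ => 1, continuousOn_const, contDiffOn_const,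
        ⟨0, by norm_num, one_ne_zero⟩, by simp, fun x _ => by simp⟩
    | succ n => exact mem_iUnion.2 ⟨n + 1, hspec n⟩
  · cases n with
    | zero => omega
    | succ n => exact hground n

theorem IsGroundEnergy.le_curvature_bound {f : ℝ → ℝ} (hf : IsProfile f)
    (hf' : ContinuousOn (deriv f) (Icc (-1) 1)) {m : ℕ} (hm : 1 ≤ m) {lam : ℝ}
    (hlam : IsGroundEnergy f m lam)
    (hint : IntervalIntegrable (fun x => f x ^ m * deriv (deriv f) x) volume (-1) 1) :
    lam ≤ (m:ℝ)^2 * ((∫ x in (-1:ℝ)..1, f x ^ (m - 1)) / (∫ x in (-1:ℝ)..1, f x ^ m))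
        + ((m:ℝ) * ∫ x in (-1:ℝ)..1, f x ^ m * (-(deriv (deriv f) x) / 2))
            / (2 * ∫ x in (-1:ℝ)..1, f x ^ m) := by
  obtain ⟨n, rfl⟩ : ∃ n, m = n + 1 := ⟨m - 1, by omega⟩
  rw [Nat.add_sub_cancel]
  have h11 : (-1:ℝ) ≤ 1 := by norm_num
  have hnn : ∀ x ∈ Icc (-1:ℝ) 1, 0 ≤ f x := by
    intro x hx
    rcases eq_or_lt_of_le hx.1 with rfl | h1
    · exact hf.zero_neg_one.ge
    rcases eq_or_lt_of_le hx.2 with rfl | h2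
    · exact hf.zero_one.ge
    exact (hf.pos x ⟨h1, h2⟩).le
  have hii : ∀ j : ℕ, IntervalIntegrable (fun x => f x ^ j) volume (-1) 1 := fun j =>
    ContinuousOn.intervalIntegrable (by rw [uIcc_of_le h11]; exact hf.contOn.pow j)
  have hpos : 0 < ∫ x in (-1:ℝ)..1, f x ^ (n + 1) :=
    intervalIntegral_pos_of_pos_on (hii _) (fun x hx => pow_pos (hf.pos x hx) _) (by norm_num)
  have hsqd : ∀ x ∈ Ioo (-1:ℝ) 1, HasDerivAt (fun x => √(f x) ^ (n + 1))
      (((n + 1 : ℕ) : ℝ) * √(f x) ^ n * (deriv f x / (2 * √(f x)))) x := fun x hx => by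
    simpa using ((hf.hasDerivAt hx).sqrt (hf.pos x hx).ne').fun_pow (n + 1)
  have key := hlam (fun x => √(f x) ^ (n + 1))
    (fun x => ((n + 1 : ℕ) : ℝ) * √(f x) ^ n * (deriv f x / (2 * √(f x))))
    (fun x => ((n + 1 : ℕ) : ℝ) / 4 * (f x ^ (n + 1) * deriv f x))
    (fun x => ((n + 1 : ℕ) : ℝ) / 4 * ((((n + 1 : ℕ) : ℝ) * f x ^ n * deriv f x) * deriv f x +
      f x ^ (n + 1) * deriv (deriv f) x))
    (fun x => ((n + 1 : ℕ) : ℝ) ^ 2 * f x ^ n -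
      ((n + 1 : ℕ) : ℝ) / 4 * (f x ^ (n + 1) * deriv (deriv f) x))
    (hf.contOn.sqrt.pow _) (by simp [hf.zero_neg_one]) (by simp [hf.zero_one]) hsqd
    (((hf.contOn.pow _).mul hf').const_mul _) (by simp [hf.zero_neg_one]) (by simp [hf.zero_one])
    (fun x hx => by
      have h := (((hf.hasDerivAt hx).pow (n + 1)).mul (hf.hasDerivAt_deriv hx)).const_mul
        (((n + 1 : ℕ) : ℝ) / 4)
      simpa using h)
    (((hii n).const_mul _).sub (hint.const_mul _))
    (fun x hx => le_of_eq (by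
      have hfx := hf.pos x hx
      obtain ⟨t, ht, hft⟩ : ∃ t, 0 < t ∧ f x = t ^ 2 :=
        ⟨√(f x), Real.sqrt_pos.2 hfx, (Real.sq_sqrt hfx.le).symm⟩
      rw [hft, Real.sqrt_sq ht.le]
      field_simp
      ring))
  have hsq : ∫ x in (-1:ℝ)..1, (√(f x) ^ (n + 1)) ^ 2 = ∫ x in (-1:ℝ)..1, f x ^ (n + 1) := by
    refine integral_congr fun x hx => ?_
    rw [uIcc_of_le h11] at hx
    rw [← pow_mul, mul_comm, pow_mul, Real.sq_sqrt (hnn x hx)]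
  rw [hsq, intervalIntegral.integral_sub ((hii n).const_mul _) (hint.const_mul _),
    intervalIntegral.integral_const_mul, intervalIntegral.integral_const_mul] at key
  have hK : ∫ x in (-1:ℝ)..1, f x ^ (n + 1) * (-(deriv (deriv f) x) / 2) =
      -(1 / 2) * ∫ x in (-1:ℝ)..1, f x ^ (n + 1) * deriv (deriv f) x := by
    rw [← intervalIntegral.integral_const_mul]
    exact integral_congr fun x _ => by ring
  rw [hK]
  refine (le_div_iff₀ hpos).2 key |>.trans_eq ?_
  field_simp
  ring

/-- Sharp upper bound for the `m`-th distinct eigenvalue: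
`λ_m ≤ m² (∫ f^{m-1} / ∫ f^m) + (m ∫ f^m K) / (2 ∫ f^m)`, with `K = -f''/2`. -/
theorem eigenvalue_sharp_upper_bound (f : ℝ → ℝ) (hf : IsProfile f)
    (hf' : ContinuousOn (deriv f) (Icc (-1) 1))
    (Λ : ℕ → ℝ) (hΛmono : StrictMono Λ) (hΛrange : Set.range Λ = Eigs f) :
    ∀ m : ℕ, 1 ≤ m →
      IntervalIntegrable (fun x => f x ^ m * deriv (deriv f) x) volume (-1) 1 →
      Λ m ≤ (m:ℝ)^2 * ((∫ x in (-1:ℝ)..1, f x ^ (m - 1)) / (∫ x in (-1:ℝ)..1, f x ^ m))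
        + ((m:ℝ) * ∫ x in (-1:ℝ)..1, f x ^ m * (-(deriv (deriv f) x) / 2))
            / (2 * ∫ x in (-1:ℝ)..1, f x ^ m) := by
  intro m hm hint
  obtain ⟨a, hamono, haeig, haground⟩ := exists_strictMono_eigs hf hf'
  refine le_trans ?_ ((haground m hm).le_curvature_bound hf hf' hm hint)
  have hex : ∀ k, ∃ n, Λ n = a k := fun k => by
    have := haeig k
    rwa [← hΛrange] at this
  choose N hN using hex
  have hNmono : StrictMono N := fun i j hij => by
    rw [← hΛmono.lt_iff_lt, hN, hN]
    exact hamono hij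
  rw [← hN m]
  exact hΛmono.monotone (hNmono.le_apply)
end
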